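/- Let F be a free group of finite rank and A a nonabelian subgroup of F. Then acl^∃(A) is compressed: for every finitely generated subgroup K with acl^∃(A) ≤ K ≤ F, one has rk(acl^∃(A)) ≤ rk(K). -/

import Mathlib

open FirstOrder Filter

/-! Common definitions: the first-order language of groups, algebraic/definable closures,
free products, amalgams, HNN extensions, etc. -/

/-- Function symbols of the language of groups: `1`, `⁻¹`, `·`. -/
inductive GrpFunc : ℕ → Type
  | one : GrpFunc 0
  | inv : GrpFunc 1
  | mul : GrpFunc 2

/-- The first-order language of groups `L = {·, ⁻¹, 1}` (no relation symbols). -/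
def grpLang : FirstOrder.Language := ⟨GrpFunc, fun _ => Empty⟩

/-- Every group is a `grpLang`-structure in the natural way. -/
instance grpStructure (G : Type*) [Group G] : grpLang.Structure G where
  funMap {_} f := match f with
    | .one => fun _ => (1 : G)
    | .inv => fun x => (x 0)⁻¹
    | .mul => fun x => x 0 * x 1
  RelMap {_} r := Empty.elim r

/-- A formula is existential if it is obtained from a quantifier-free formula by
prefixing existential quantifiers. -/
def IsExistential {L : FirstOrder.Language} {α : Type*} (φ : L.Formula α) : Prop :=
  ∃ (n : ℕ) (ψ : L.BoundedFormula α n), ψ.IsQF ∧ φ = ψ.exs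

section ModelTheory

variable (L : FirstOrder.Language) {M : Type*} [L.Structure M]

/-- The algebraic closure of a set of parameters `A` in an `L`-structure `M`:
elements satisfying, together with only finitely many other elements, some formula
with parameters from `A`. -/
def Lacl (A : Set M) : Set M :=
  {b | ∃ φ : L.Formula (↥A ⊕ Fin 1),
    {c : M | φ.Realize (Sum.elim Subtype.val fun _ => c)}.Finite ∧
    φ.Realize (Sum.elim Subtype.val fun _ => b)}

/-- The definable closure of a set of parameters `A` in an `L`-structure `M`. -/
def Ldcl (A : Set M) : Set M :=
  {b | ∃ φ : L.Formula (↥A ⊕ Fin 1),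
    {c : M | φ.Realize (Sum.elim Subtype.val fun _ => c)} = {b}}

/-- The existential algebraic closure of `A` in `M`. -/
def LaclE (A : Set M) : Set M :=
  {b | ∃ φ : L.Formula (↥A ⊕ Fin 1), IsExistential φ ∧
    {c : M | φ.Realize (Sum.elim Subtype.val fun _ => c)}.Finite ∧
    φ.Realize (Sum.elim Subtype.val fun _ => b)}

/-- The existential definable closure of `A` in `M`. -/
def LdclE (A : Set M) : Set M :=
  {b | ∃ φ : L.Formula (↥A ⊕ Fin 1), IsExistential φ ∧
    {c : M | φ.Realize (Sum.elim Subtype.val fun _ => c)} = {b}}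

end ModelTheory

section GroupDefs

variable {G : Type*} [Group G]

/-- Algebraic closure in a group, w.r.t. the language of groups. -/
def acl (A : Set G) : Set G := Lacl grpLang A

/-- Definable closure in a group, w.r.t. the language of groups. -/
def dcl (A : Set G) : Set G := Ldcl grpLang A

/-- Existential algebraic closure in a group. -/
def aclE (A : Set G) : Set G := LaclE grpLang A

/-- Existential definable closure in a group. -/
def dclE (A : Set G) : Set G := LdclE grpLang A

/-- Restricted algebraic closure: elements with finite orbit under automorphisms
of `G` fixing `A` pointwise. -/
def racl (A : Set G) : Set G :=
  {g | {x : G | ∃ f : G ≃* G, (∀ a ∈ A, f a = a) ∧ f g = x}.Finite}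

/-- Restricted definable closure: elements fixed by every automorphism of `G`
fixing `A` pointwise. -/
def rdcl (A : Set G) : Set G :=
  {g | ∀ f : G ≃* G, (∀ a ∈ A, f a = a) → f g = g}

/-- A set of group elements is nonabelian (contains two non-commuting elements). -/
def Nonabelian (A : Set G) : Prop := ∃ x ∈ A, ∃ y ∈ A, x * y ≠ y * x

/-- `F` is a free group of finite rank. -/
def IsFreeOfFiniteRank (F : Type*) [Group F] : Prop :=
  ∃ n : ℕ, Nonempty (F ≃* FreeGroup (Fin n))

/-- `G` is the internal free product of its subgroups `H` and `K`: the canonical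
homomorphism from the abstract free product `H ∗ K` to `G` is an isomorphism. -/
def InternalFreeProduct (H K : Subgroup G) : Prop :=
  Function.Bijective (Monoid.Coprod.lift H.subtype K.subtype)

/-- `G` is freely indecomposable relative to its subgroup `A`. -/
def FreelyIndecomposableRel (A : Subgroup G) : Prop :=
  ¬ ∃ G₁ G₂ : Subgroup G, G₁ ≠ ⊥ ∧ G₂ ≠ ⊥ ∧ A ≤ G₁ ∧ InternalFreeProduct G₁ G₂

/-- `B` is a free factor of the subgroup `K`: there is `L` such that the canonical
homomorphism from the abstract free product `B ∗ L` to the ambient group is injective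
with image exactly `K`. -/
def IsFreeFactorOf (B K : Subgroup G) : Prop :=
  ∃ L : Subgroup G,
    Function.Injective (Monoid.Coprod.lift B.subtype L.subtype) ∧
    (Monoid.Coprod.lift B.subtype L.subtype).range = K

/-- `K'` is the amalgamated free product `K ∗_C B` inside the ambient group `G`:
the canonical homomorphism from the abstract amalgamated product (pushout) of `K` and
`B` over `C` to `G` is injective with image exactly `K'`. -/
def IsAmalgamOf (K B C : Subgroup G) (hCK : C ≤ K) (hCB : C ≤ B) (K' : Subgroup G) : Prop :=
  ∃ ℓ : Monoid.PushoutI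
      (fun i : Bool =>
        (Subgroup.inclusion (show C ≤ cond i K B by cases i <;> assumption) :
          ↥C →* ↥(cond i K B))) →* G,
    (∀ i : Bool, ℓ.comp (Monoid.PushoutI.of i) = (cond i K B).subtype) ∧
    Function.Injective ℓ ∧ ℓ.range = K'

/-- `K'` is the HNN extension of `K` along `φ : C ≃* D` inside the ambient group `G`:
the canonical homomorphism from the abstract HNN extension of `K` along `φ` to `G` is
injective with image exactly `K'` (and is the inclusion on `K`). -/
def IsHNNOf (K : Subgroup G) {C D : Subgroup ↥K} (φ : ↥C ≃* ↥D) (K' : Subgroup G) : Prop :=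
  ∃ ℓ : HNNExtension ↥K C D φ →* G,
    ℓ.comp HNNExtension.of = K.subtype ∧ Function.Injective ℓ ∧ ℓ.range = K'

/-- One constructibility step: `K'` is an amalgamated free product of `K` with some
subgroup over a cyclic subgroup, or an HNN extension of `K` along an isomorphism of two
cyclic subgroups of `K`. -/
def ConstructStep (K K' : Subgroup G) : Prop :=
  (∃ (B C : Subgroup G) (hCK : C ≤ K) (hCB : C ≤ B),
      (∃ c : G, C = Subgroup.zpowers c) ∧ B ≤ K' ∧ K ≤ K' ∧ IsAmalgamOf K B C hCK hCB K')
  ∨ (∃ (C D : Subgroup ↥K) (φ : ↥C ≃* ↥D),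
      (∃ c : ↥K, C = Subgroup.zpowers c) ∧ (∃ d : ↥K, D = Subgroup.zpowers d) ∧ IsHNNOf K φ K')

/-- `B` is constructible from `A` by a finite sequence of amalgamated free products and
HNN-extensions along cyclic subgroups. -/
def ConstructibleFrom (A B : Subgroup G) : Prop := Relation.ReflTransGen ConstructStep A B

/-- The rank of a subgroup: the least cardinality of a generating set. For (subgroups of)
free groups this is the cardinality of a basis. -/
noncomputable def srank (H : Subgroup G) : Cardinal :=
  sInf {c : Cardinal | ∃ S : Set G, Subgroup.closure S = H ∧ c = Cardinal.mk ↥S}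

/-- `M` is a maximal abelian subgroup. -/
def IsMaxAbelian (M : Subgroup G) : Prop :=
  (∀ x ∈ M, ∀ y ∈ M, x * y = y * x) ∧
  ∀ N : Subgroup G, (∀ x ∈ N, ∀ y ∈ N, x * y = y * x) → M ≤ N → M = N

/-- `M` is a maximal abelian subgroup of the subgroup `H`. -/
def IsMaxAbelianIn (M H : Subgroup G) : Prop :=
  M ≤ H ∧ (∀ x ∈ M, ∀ y ∈ M, x * y = y * x) ∧
  ∀ N : Subgroup G, N ≤ H → (∀ x ∈ N, ∀ y ∈ N, x * y = y * x) → M ≤ N → M = N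

/-- `M` is a malnormal subgroup: `gMg⁻¹ ∩ M = 1` for every `g ∉ M`. -/
def Malnormal (M : Subgroup G) : Prop :=
  ∀ g : G, g ∉ M → ∀ x ∈ M, g * x * g⁻¹ ∈ M → x = 1

/-- A group is CSA if every maximal abelian subgroup is malnormal. -/
def IsCSA (G : Type*) [Group G] : Prop := ∀ M : Subgroup G, IsMaxAbelian M → Malnormal M

/-- Every abelian subgroup of `G` is cyclic. -/
def AbelianSubgroupsCyclic (G : Type*) [Group G] : Prop :=
  ∀ H : Subgroup G, (∀ x ∈ H, ∀ y ∈ H, x * y = y * x) → ∃ g : G, H = Subgroup.zpowers g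

/-- `G` is equationally noetherian: every system of equations over `G` in finitely many
variables is equivalent to a finite subsystem. -/
def EqNoetherian (G : Type*) [Group G] : Prop :=
  ∀ n : ℕ, 0 < n → ∀ S : Set (Monoid.Coprod G (FreeGroup (Fin n))),
    ∃ S₀ : Set (Monoid.Coprod G (FreeGroup (Fin n))), S₀ ⊆ S ∧ S₀.Finite ∧
      ∀ f : Monoid.Coprod G (FreeGroup (Fin n)) →* G,
        f.comp Monoid.Coprod.inl = MonoidHom.id G →
        ((∀ s ∈ S₀, f s = 1) ↔ ∀ s ∈ S, f s = 1)

/-- A group homomorphism is elementary w.r.t. the language of groups: it preserves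
and reflects all first-order formulas. -/
def ElementaryEmb {H K : Type*} [Group H] [Group K] (e : H →* K) : Prop :=
  ∀ (n : ℕ) (φ : grpLang.Formula (Fin n)) (v : Fin n → H),
    (φ.Realize fun i => e (v i)) ↔ φ.Realize v

/-- The inclusion of the subgroup `H` is an elementary embedding; i.e. the ambient group
is an elementary extension of `H`. -/
def ElementarySub (H : Subgroup G) : Prop := ElementaryEmb H.subtype

/-- A sequence of homomorphisms is stable. -/
def StableSeq {K H : Type*} [Group K] [Group H] (h : ℕ → (K →* H)) : Prop :=
  ∀ k : K, (∀ᶠ n in Filter.atTop, h n k = 1) ∨ (∀ᶠ n in Filter.atTop, h n k ≠ 1)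

/-- A sequence of homomorphisms has trivial stable kernel. -/
def TrivialStableKernel {K H : Type*} [Group K] [Group H] (h : ℕ → (K →* H)) : Prop :=
  ∀ k : K, (∀ᶠ n in Filter.atTop, h n k = 1) → k = 1

/-- A stable sequence of homomorphisms `g n : D → H` with trivial stable kernel strongly
converges to `D`, where `D` is a subgroup of an extension of the base group `H`, the base
group being embedded via `e`. -/
def StronglyConverges {H Gs : Type*} [Group H] [Group Gs] (e : H →* Gs)
    (D : Subgroup Gs) (g : ℕ → (↥D →* H)) : Prop :=
  StableSeq g ∧ TrivialStableKernel g ∧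
  (∀ (d : ↥D) (b : H), (d : Gs) = e b → ∀ᶠ n in Filter.atTop, g n d = b) ∧
  (∀ (d : ↥D) (b : H), (∃ᶠ n in Filter.atTop, g n d = b) → (d : Gs) = e b)

/-- The ball of radius `r` about the identity in the word metric w.r.t. `S`. -/
def wordBall (S : Set G) (r : ℕ) : Set G :=
  {g | ∃ l : List G, l.length ≤ r ∧ (∀ x ∈ l, x ∈ S ∨ x⁻¹ ∈ S) ∧ l.prod = g}

end GroupDefs

/-! ### Cocycles of free groups -/

/-- A map defined on generators of a free group extends uniquely to a cocycle. -/
theorem FreeGroupBasis.exists_cocycle {ι K Y M : Type*} [Group K] [MulAction K Y] [Group M]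
    (b : FreeGroupBasis ι K) (μ : Y → ι → M) :
    ∃ c : K → Y → M, (∀ g h y, c (g * h) y = c g (h • y) * c h y) ∧
      ∀ i y, c (b i) y = μ y i := by
  let s : K →* (Y → M) ⋊[mulAutArrow] K :=
    b.lift fun i => ⟨fun z => μ ((b i)⁻¹ • z) i, b i⟩
  have hs : ∀ i, s (b i) = ⟨fun z => μ ((b i)⁻¹ • z) i, b i⟩ := fun i => by simp [s]
  have hr : ∀ g, (s g).right = g := fun g => DFunLike.congr_fun
    (b.ext_hom (SemidirectProduct.rightHom.comp s) (MonoidHom.id K) fun i => by simp [hs]) g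
  refine ⟨fun g y => (s g).left (g • y), fun g h y => ?_, fun i y => ?_⟩
  · simp only [map_mul, SemidirectProduct.mul_left, hr, Pi.mul_apply]
    congr 1
    · rw [mul_smul]
    · change (s h).left (g⁻¹ • (g * h) • y) = _
      rw [mul_smul, inv_smul_smul]
  · simp [hs]

/-! ### Finite graphs -/

/-- Every vertex in `V` is linked to `v₀` by edges in `E`. -/
def GraphLinked {ε Y : Type*} (s t : ε → Y) (E : Finset ε) (V : Finset Y) (v₀ : Y) : Prop :=
  ∀ C : Y → Prop, C v₀ → (∀ e ∈ E, C (s e) ↔ C (t e)) → ∀ v ∈ V, C v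

theorem GraphLinked.exists_spanningTree {ε Y K : Type*} [Group K] {s t : ε → Y} {E : Finset ε}
    {V : Finset Y} {v₀ : Y} (hc : GraphLinked s t E V v₀) (hv₀ : v₀ ∈ V)
    (hE : ∀ e ∈ E, s e ∈ V ∧ t e ∈ V) (φ : ε → K) :
    ∃ Tr ⊆ E, ∃ (k : Y → K) (child : ε → Y), Tr.card + 1 = V.card ∧ GraphLinked s t Tr V v₀ ∧
      k v₀ = 1 ∧ (∀ e ∈ Tr, k (t e) = φ e * k (s e)) ∧ Set.InjOn child Tr ∧
      ∀ e ∈ Tr, child e ∈ V ∧ child e ≠ v₀ ∧ (child e = s e ∨ child e = t e) := by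
  classical
  have main : ∀ m, m + 1 ≤ V.card → ∃ R ⊆ V, ∃ Tr ⊆ E, ∃ (k : Y → K) (child : ε → Y),
      v₀ ∈ R ∧ R.card = m + 1 ∧ Tr.card = m ∧ (∀ e ∈ Tr, s e ∈ R ∧ t e ∈ R) ∧
      GraphLinked s t Tr R v₀ ∧
      k v₀ = 1 ∧ (∀ e ∈ Tr, k (t e) = φ e * k (s e)) ∧ Set.InjOn child Tr ∧
      ∀ e ∈ Tr, child e ∈ R ∧ child e ≠ v₀ ∧ (child e = s e ∨ child e = t e) := by
    intro m
    induction m with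
    | zero =>
      intro _
      refine ⟨{v₀}, by simpa using hv₀, ∅, by simp, fun _ => 1, s, by simp, by simp, by simp,
        by simp, ?_, rfl, by simp, by simp, by simp⟩
      intro C h0 _ v hv
      rw [Finset.mem_singleton.1 hv]
      exact h0
    | succ m ih =>
      intro hm
      obtain ⟨R, hRV, Tr, hTr, k, child, h0R, hRc, hTc, hTR, hlink, hk0, hk, hinj, hch⟩ :=
        ih (by omega)
      have key : ∀ e ∈ E, ∀ w ∈ V, w ∉ R → ∀ g : K,
          ((w = t e ∧ s e ∈ R ∧ g = φ e * k (s e)) ∨ (w = s e ∧ t e ∈ R ∧ g = (φ e)⁻¹ * k (t e))) →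
          ∃ R ⊆ V, ∃ Tr ⊆ E, ∃ (k : Y → K) (child : ε → Y),
            v₀ ∈ R ∧ R.card = m + 1 + 1 ∧ Tr.card = m + 1 ∧ (∀ e ∈ Tr, s e ∈ R ∧ t e ∈ R) ∧
            GraphLinked s t Tr R v₀ ∧
            k v₀ = 1 ∧ (∀ e ∈ Tr, k (t e) = φ e * k (s e)) ∧ Set.InjOn child Tr ∧
            ∀ e ∈ Tr, child e ∈ R ∧ child e ≠ v₀ ∧ (child e = s e ∨ child e = t e) := by
        intro e he w hwV hwR g hg
        have heT : e ∉ Tr := by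
          intro h
          have := hTR e h
          rcases hg with ⟨rfl, -⟩ | ⟨rfl, -⟩ <;> tauto
        have hne : ∀ f ∈ Tr, f ≠ e := by rintro f hf rfl; exact heT hf
        have hneR : ∀ u ∈ R, u ≠ w := by rintro f hf rfl; exact hwR hf
        refine ⟨insert w R, Finset.insert_subset hwV hRV, insert e Tr,
          Finset.insert_subset he hTr, Function.update k w g, Function.update child e w,
          by simp [h0R], by simp [hwR, hRc], by simp [heT, hTc], ?_, ?_, ?_, ?_, ?_, ?_⟩
        · intro f hf
          rcases Finset.mem_insert.1 hf with rfl | hf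
          · rcases hg with ⟨rfl, h, -⟩ | ⟨rfl, h, -⟩ <;> simp [h]
          · simp [hTR f hf]
        · intro C hC0 hC v hv
          have hR : ∀ v ∈ R, C v := hlink C hC0 fun f hf => hC f (by simp [hf])
          rcases Finset.mem_insert.1 hv with rfl | hv
          · have := hC e (by simp)
            rcases hg with ⟨rfl, h, -⟩ | ⟨rfl, h, -⟩
            · exact this.1 (hR _ h)
            · exact this.2 (hR _ h)
          · exact hR v hv
        · rw [Function.update_of_ne (hneR _ h0R), hk0]
        · intro f hf
          rcases Finset.mem_insert.1 hf with rfl | hf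
          · rcases hg with ⟨rfl, h, rfl⟩ | ⟨rfl, h, rfl⟩ <;> simp [Function.update_of_ne (hneR _ h)]
          · rw [Function.update_of_ne (hneR _ (hTR f hf).1),
              Function.update_of_ne (hneR _ (hTR f hf).2), hk f hf]
        · intro f hf f' hf' hff
          simp only [Finset.coe_insert, Set.mem_insert_iff, Finset.mem_coe] at hf hf'
          rcases hf with rfl | hf <;> rcases hf' with rfl | hf'
          · rfl
          · rw [Function.update_self, Function.update_of_ne (hne _ hf')] at hff
            exact absurd hff.symm (hneR _ (hch _ hf').1)
          · rw [Function.update_self, Function.update_of_ne (hne _ hf)] at hff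
            exact absurd hff (hneR _ (hch _ hf).1)
          · rw [Function.update_of_ne (hne _ hf), Function.update_of_ne (hne _ hf')] at hff
            exact hinj hf hf' hff
        · intro f hf
          rcases Finset.mem_insert.1 hf with rfl | hf
          · rw [Function.update_self]
            refine ⟨by simp, (hneR _ h0R).symm, ?_⟩
            rcases hg with ⟨h, -⟩ | ⟨h, -⟩ <;> simp [h]
          · rw [Function.update_of_ne (hne _ hf)]
            obtain ⟨h1, h2, h3⟩ := hch f hf
            exact ⟨by simp [h1], h2, h3⟩
      by_cases hcross : ∀ e ∈ E, s e ∈ R ↔ t e ∈ R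
      · have : V ⊆ R := hc (· ∈ R) h0R hcross
        have := Finset.card_le_card this
        omega
      · push Not at hcross
        obtain ⟨e, he, h | h⟩ := hcross
        · exact key e he (t e) (hE e he).2 h.2 _ (Or.inl ⟨rfl, h.1, rfl⟩)
        · exact key e he (s e) (hE e he).1 h.1 _ (Or.inr ⟨rfl, h.2, rfl⟩)
  have hpos : 0 < V.card := Finset.card_pos.2 ⟨_, hv₀⟩
  obtain ⟨R, hRV, Tr, hTr, k, child, h0R, hRc, hTc, hTR, hlink, hk0, hk, hinj, hch⟩ :=
    main (V.card - 1) (by omega)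
  obtain rfl : R = V := Finset.eq_of_subset_of_card_le hRV (by omega)
  exact ⟨Tr, hTr, k, child, by omega, hlink, hk0, hk, hinj, hch⟩

/-- The connected component of a vertex of a finite graph. -/
theorem exists_graphComponent {ε Y : Type*} (s t : ε → Y) (E : Finset ε) (V : Finset Y)
    (hE : ∀ e ∈ E, s e ∈ V ∧ t e ∈ V) {v₀ : Y} (hv₀ : v₀ ∈ V) :
    ∃ V₁ ⊆ V, ∃ E₁ ⊆ E, v₀ ∈ V₁ ∧ (∀ e ∈ E₁, s e ∈ V₁ ∧ t e ∈ V₁) ∧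
      GraphLinked s t E₁ V₁ v₀ ∧ (∀ e ∈ E, e ∉ E₁ → s e ∉ V₁ ∧ t e ∉ V₁) := by
  classical
  let Cl : Y → Prop := fun v => ∀ C : Y → Prop, C v₀ → (∀ e ∈ E, C (s e) ↔ C (t e)) → C v
  have hCl : ∀ e ∈ E, Cl (s e) ↔ Cl (t e) := fun e he =>
    ⟨fun h C h0 hC => (hC e he).1 (h C h0 hC), fun h C h0 hC => (hC e he).2 (h C h0 hC)⟩
  refine ⟨V.filter Cl, Finset.filter_subset _ _, E.filter fun e => Cl (s e),
    Finset.filter_subset _ _, ?_, ?_, ?_, ?_⟩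
  · exact Finset.mem_filter.2 ⟨hv₀, fun C h0 _ => h0⟩
  · intro e he
    obtain ⟨he, h⟩ := Finset.mem_filter.1 he
    exact ⟨Finset.mem_filter.2 ⟨(hE e he).1, h⟩, Finset.mem_filter.2 ⟨(hE e he).2, (hCl e he).1 h⟩⟩
  · intro C h0 hC v hv
    refine ((Finset.mem_filter.1 hv).2 (fun v => Cl v ∧ C v) ⟨fun C h0 _ => h0, h0⟩ ?_).2
    intro e he
    constructor
    · rintro ⟨h1, h2⟩
      exact ⟨(hCl e he).1 h1, (hC e (Finset.mem_filter.2 ⟨he, h1⟩)).1 h2⟩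
    · rintro ⟨h1, h2⟩
      exact ⟨(hCl e he).2 h1, (hC e (Finset.mem_filter.2 ⟨he, (hCl e he).2 h1⟩)).2 h2⟩
  · intro e he hne
    have : ¬ Cl (s e) := fun h => hne (Finset.mem_filter.2 ⟨he, h⟩)
    exact ⟨fun h => this (Finset.mem_filter.1 h).2,
      fun h => this ((hCl e he).2 (Finset.mem_filter.1 h).2)⟩

theorem sum_le_sum_of_connected {ε Y : Type*} (s t : ε → Y) (a : ε → ℤ) (b : Y → ℤ)
    (V : Finset Y) : ∀ E : Finset ε, (∀ e ∈ E, s e ∈ V ∧ t e ∈ V) →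
    (∀ V₁ ⊆ V, ∀ E₁ ⊆ E, ∀ v₀ ∈ V₁, (∀ e ∈ E₁, s e ∈ V₁ ∧ t e ∈ V₁) →
      GraphLinked s t E₁ V₁ v₀ → ∑ v ∈ V₁, b v ≤ ∑ e ∈ E₁, a e) →
    ∑ v ∈ V, b v ≤ ∑ e ∈ E, a e := by
  classical
  induction V using Finset.strongInduction with
  | H V ih =>
  intro E hE h
  rcases V.eq_empty_or_nonempty with rfl | ⟨v₀, hv₀⟩
  · obtain rfl : E = ∅ := Finset.eq_empty_of_forall_notMem fun e he => by simpa using (hE e he).1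
    simp
  obtain ⟨V₁, hV₁, E₁, hE₁, h0, hok, hlink, hout⟩ := exists_graphComponent s t E V hE hv₀
  have h1 := h V₁ hV₁ E₁ hE₁ v₀ h0 hok hlink
  have h2 := ih (V \ V₁) (Finset.sdiff_ssubset hV₁ ⟨v₀, h0⟩) (E \ E₁) (fun e he => by
      obtain ⟨he, hne⟩ := Finset.mem_sdiff.1 he
      simp [hE e he, hout e he hne])
    fun V₂ hV₂ E₂ hE₂ => h V₂ (hV₂.trans Finset.sdiff_subset) E₂ (hE₂.trans Finset.sdiff_subset)
  rw [← Finset.sum_sdiff hV₁, ← Finset.sum_sdiff hE₁]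
  linarith

/-- In an action of a free group with abelian point stabilizers, a finite subgraph of the action
graph has at most as many edges as vertices. -/
theorem FreeGroupBasis.card_edges_le {ι K Y : Type*} [Group K] [MulAction K Y]
    (b : FreeGroupBasis ι K) (V : Finset Y) (E : Finset (Y × ι))
    (hE : ∀ e ∈ E, e.1 ∈ V ∧ b e.2 • e.1 ∈ V)
    (hcomm : ∀ y ∈ V, ∀ g h : K, g • y = y → h • y = y → g * h = h * g) :
    E.card ≤ V.card := by
  classical
  have := sum_le_sum_of_connected (fun e : Y × ι => e.1) (fun e => b e.2 • e.1) (fun _ => -1)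
    (fun _ => -1) V E hE ?_
  · simpa using this
  intro V₁ hV₁ E₁ _ v₀ hv₀ hok hlink
  simp only [Finset.sum_neg_distrib, Finset.sum_const, nsmul_eq_mul, mul_one, neg_le_neg_iff,
    Nat.cast_le]
  by_contra! hlt
  obtain ⟨Tr, hTr, k, -, hcard, hTl, hk0, hk, -⟩ :=
    hlink.exists_spanningTree hv₀ hok fun e => b e.2
  have h2 : 1 < (E₁ \ Tr).card := by rw [Finset.card_sdiff_of_subset hTr]; omega
  obtain ⟨e, he, f, hf, hef⟩ := Finset.one_lt_card.1 h2
  rw [Finset.mem_sdiff] at he hf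
  let p : Equiv.Perm (Fin 3) := Equiv.swap 0 1
  let q : Equiv.Perm (Fin 3) := Equiv.swap 1 2
  have hpq : p * q ≠ q * p := by decide
  obtain ⟨c, hc, hcb⟩ := b.exists_cocycle
    fun y i => if (y, i) = e then p else if (y, i) = f then q else 1
  have hc1 : ∀ y, c 1 y = 1 := fun y => by simpa using hc 1 1 y
  have hkv : ∀ v ∈ V₁, k v • v₀ = v := by
    refine hTl (fun v => k v • v₀ = v) (by simp [hk0]) fun g hg => ?_
    simp only [hk g hg, mul_smul, smul_left_cancel_iff]
  have hck : ∀ v ∈ V₁, c (k v) v₀ = 1 := by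
    refine hTl (fun v => c (k v) v₀ = 1) (by simp [hk0, hc1]) fun g hg => ?_
    have hge : g ≠ e := by rintro rfl; exact he.2 hg
    have hgf : g ≠ f := by rintro rfl; exact hf.2 hg
    simp only [hk g hg, hc, hkv _ (hok g (hTr hg)).1, hcb, Prod.mk.eta, hge, hgf, if_false, one_mul]
  obtain ⟨γ, hγd⟩ : ∃ γ : Y × ι → K, ∀ g, γ g = (k (b g.2 • g.1))⁻¹ * (b g.2 * k g.1) :=
    ⟨_, fun _ => rfl⟩
  have hγ : ∀ g ∈ E₁, γ g • v₀ = v₀ := fun g hg => by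
    simp only [hγd, mul_smul, hkv _ (hok g hg).1]
    rw [inv_smul_eq_iff, hkv _ (hok g hg).2]
  have hcγ : ∀ g ∈ E₁, c (γ g) v₀ = if g = e then p else if g = f then q else 1 := by
    intro g hg
    have h1 : c (k (b g.2 • g.1) * γ g) v₀ = c (b g.2 * k g.1) v₀ := by
      rw [hγd, mul_inv_cancel_left]
    rw [hc, hγ g hg, hck _ (hok g hg).2, one_mul, hc, hkv _ (hok g hg).1, hck _ (hok g hg).1,
      hcb] at h1
    simpa using h1
  have h3 := hcomm v₀ (hV₁ hv₀) (γ e) (γ f) (hγ e he.1) (hγ f hf.1)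
  have h4 : c (γ e * γ f) v₀ = c (γ f * γ e) v₀ := by rw [h3]
  rw [hc, hc, hγ e he.1, hγ f hf.1, hcγ e he.1, hcγ f hf.1] at h4
  simp only [if_true, hef.symm, if_false] at h4
  exact hpq h4

/-! ### Finite subsets of metric trees -/

/-- A geodesic metric space satisfying the four-point condition. -/
structure IsMetricTree (T : Type*) [MetricSpace T] : Prop where
  four_point : ∀ w x y z : T,
    dist w x + dist y z ≤ max (dist w y + dist x z) (dist w z + dist x y)
  geodesic : ∀ (p q : T) (r : ℝ), 0 ≤ r → r ≤ dist p q →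
    ∃ m, dist p m = r ∧ dist m q = dist p q - r

namespace MetricTree

variable {T : Type*} [MetricSpace T]

/-- Twice the Gromov product of `u` and `v` at `p`. -/
def gp (p u v : T) : ℝ := dist p u + dist p v - dist u v

/-- The direction at `p` of a point `u ≠ p`. -/
def dir (p u : T) : Set T := {v | 0 < gp p u v}

open Classical in
/-- The directions at `p` of the points of `Ω`. -/
noncomputable def dirs (Ω : Finset T) (p : T) : Finset (Set T) := (Ω.erase p).image (dir p)

/-- The convex hull of a finite set of points of a tree. -/
def hull (Ω : Finset T) : Set T := {p | ∃ u ∈ Ω, ∃ v ∈ Ω, gp p u v = 0}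

open Classical in
/-- The contribution of `p` to twice the Euler characteristic of the hull of `Ω`. -/
noncomputable def weight (Ω : Finset T) (p : T) : ℤ :=
  if p ∈ hull Ω then 2 - ((dirs Ω p).card : ℤ) else 0

theorem gp_nonneg (p u v : T) : 0 ≤ gp p u v := by
  have := dist_triangle u p v
  rw [dist_comm u p] at this
  unfold gp
  linarith

theorem gp_comm (p u v : T) : gp p u v = gp p v u := by
  unfold gp
  rw [dist_comm u v]
  ring

theorem gp_self_right (p u : T) : gp p u p = 0 := by
  simp [gp, dist_comm]

theorem gp_same (p u : T) : gp p u u = 2 * dist p u := by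
  simp only [gp, dist_self]
  ring

theorem min_gp_le (hT : IsMetricTree T) (p u v w : T) :
    min (gp p u w) (gp p w v) ≤ gp p u v := by
  have := hT.four_point p w u v
  unfold gp
  rw [dist_comm w v, dist_comm w u] at this
  rw [dist_comm w v]
  rcases le_max_iff.1 this with h | h
  · exact min_le_of_right_le (by linarith)
  · exact min_le_of_left_le (by linarith)

theorem gp_pos_trans (hT : IsMetricTree T) {p u v w : T} (h1 : 0 < gp p u w) (h2 : 0 < gp p w v) :
    0 < gp p u v :=
  (lt_min h1 h2).trans_le (min_gp_le hT p u v w)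

theorem mem_dir_self {p u : T} (h : u ≠ p) : u ∈ dir p u := by
  have := dist_pos.2 h.symm
  simp only [dir, Set.mem_ofPred_eq, gp_same]
  positivity

theorem dir_eq_iff (hT : IsMetricTree T) {p u v : T} (hv : v ≠ p) :
    dir p u = dir p v ↔ 0 < gp p u v := by
  constructor
  · intro h
    have := mem_dir_self hv
    rwa [← h] at this
  · intro h
    ext w
    exact ⟨fun hw => gp_pos_trans hT (by rwa [gp_comm]) hw, fun hw => gp_pos_trans hT h hw⟩

theorem mem_dirs {Ω : Finset T} {p : T} {δ : Set T} :
    δ ∈ dirs Ω p ↔ ∃ u ∈ Ω, u ≠ p ∧ dir p u = δ := by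
  classical
  simp only [dirs, Finset.mem_image, Finset.mem_erase]
  exact ⟨fun ⟨u, h, h'⟩ => ⟨u, h.2, h.1, h'⟩, fun ⟨u, h, h', h''⟩ => ⟨u, ⟨h', h⟩, h''⟩⟩

theorem subset_hull {Ω : Finset T} {p : T} (hp : p ∈ Ω) : p ∈ hull Ω :=
  ⟨p, hp, p, hp, by simp [gp]⟩

theorem hull_mono {Ω Ω' : Finset T} (h : Ω ⊆ Ω') : hull Ω ⊆ hull Ω' :=
  fun _ ⟨u, hu, v, hv, e⟩ => ⟨u, h hu, v, h hv, e⟩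

theorem dirs_mono {Ω Ω' : Finset T} (h : Ω ⊆ Ω') (p : T) : dirs Ω p ⊆ dirs Ω' p := by
  intro δ hδ
  obtain ⟨u, hu, hp, e⟩ := mem_dirs.1 hδ
  exact mem_dirs.2 ⟨u, h hu, hp, e⟩

theorem weight_of_mem {Ω : Finset T} {p : T} (h : p ∈ hull Ω) :
    weight Ω p = 2 - ((dirs Ω p).card : ℤ) := if_pos h

theorem weight_of_notMem {Ω : Finset T} {p : T} (h : p ∉ hull Ω) : weight Ω p = 0 := if_neg h

/-- A point of a segment cannot be separated from both endpoints by another point. -/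
theorem exists_gp_pos_of_mem_hull {Ω : Finset T} {p m : T} (hm : m ∈ hull Ω) (hpm : p ≠ m) :
    ∃ a ∈ Ω, 0 < gp p m a := by
  obtain ⟨a, ha, b, hb, hab⟩ := hm
  by_contra! h
  have h1 := h a ha
  have h2 := h b hb
  have h3 := dist_pos.2 hpm
  have h4 := dist_triangle a p b
  unfold gp at h1 h2 hab
  rw [dist_comm a p] at h4
  linarith

theorem mem_hull_of_gp_eq_zero (hT : IsMetricTree T) {Ω : Finset T} {p m u : T} (hm : m ∈ hull Ω)
    (hu : u ∈ Ω) (h : gp p m u = 0) : p ∈ hull Ω := by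
  by_cases hpm : p = m
  · rwa [hpm]
  obtain ⟨a, ha, hpos⟩ := exists_gp_pos_of_mem_hull hm hpm
  refine ⟨a, ha, u, hu, ?_⟩
  have h1 := min_gp_le hT p m u a
  have h2 := gp_nonneg p a u
  rw [h] at h1
  rcases min_le_iff.1 h1 with h1 | h1 <;> linarith

theorem two_le_card_dirs (hT : IsMetricTree T) {Ω : Finset T} {p : T} (hp : p ∈ hull Ω)
    (hpΩ : p ∉ Ω) : 2 ≤ (dirs Ω p).card := by
  obtain ⟨u, hu, v, hv, h⟩ := hp
  have hup : u ≠ p := by rintro rfl; exact hpΩ hu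
  have hvp : v ≠ p := by rintro rfl; exact hpΩ hv
  refine Finset.one_lt_card.2 ⟨dir p u, mem_dirs.2 ⟨u, hu, hup, rfl⟩, dir p v,
    mem_dirs.2 ⟨v, hv, hvp, rfl⟩, fun e => ?_⟩
  have := (dir_eq_iff hT hvp).1 e
  linarith

theorem card_dirs_of_notMem_hull (hT : IsMetricTree T) {Ω : Finset T} (hΩ : Ω.Nonempty) {p : T}
    (hp : p ∉ hull Ω) : (dirs Ω p).card = 1 := by
  obtain ⟨u, hu⟩ := hΩ
  have hne : ∀ v ∈ Ω, v ≠ p := by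
    rintro v hv rfl
    exact hp (subset_hull hv)
  refine Finset.card_eq_one.2 ⟨dir p u, Finset.eq_singleton_iff_unique_mem.2
    ⟨mem_dirs.2 ⟨u, hu, hne u hu, rfl⟩, fun δ hδ => ?_⟩⟩
  obtain ⟨v, hv, hvp, rfl⟩ := mem_dirs.1 hδ
  refine (dir_eq_iff hT (hne u hu)).2 ((gp_nonneg _ _ _).lt_of_ne fun h => hp ?_)
  exact ⟨v, hv, u, hu, h.symm⟩

open Classical in
theorem dirs_insert_of_ne (Ω : Finset T) {v p : T} (h : v ≠ p) :
    dirs (insert v Ω) p = insert (dir p v) (dirs Ω p) := by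
  rw [dirs, Finset.erase_insert_of_ne h, Finset.image_insert, dirs]

open Classical in
theorem dirs_insert_self (Ω : Finset T) (v : T) : dirs (insert v Ω) v = dirs Ω v := by
  unfold dirs
  congr 1
  ext u
  simp only [Finset.mem_erase, Finset.mem_insert]
  tauto

open Classical in
theorem weight_insert_of_mem_hull (hT : IsMetricTree T) {Ω : Finset T} {v : T} (hv : v ∈ hull Ω)
    (p : T) : weight (insert v Ω) p = weight Ω p := by
  have hh : hull (insert v Ω) = hull Ω := by
    refine (hull_mono (Finset.subset_insert _ _)).antisymm' ?_
    rintro q ⟨a, ha, b, hb, hab⟩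
    rcases Finset.mem_insert.1 ha with ea | ha' <;> rcases Finset.mem_insert.1 hb with eb | hb'
    · rw [ea, eb, gp_same] at hab
      rwa [show q = v from dist_eq_zero.1 (by linarith)]
    · exact mem_hull_of_gp_eq_zero hT hv hb' (by rwa [← ea])
    · exact mem_hull_of_gp_eq_zero hT hv ha' (by rwa [gp_comm, ← eb])
    · exact ⟨a, ha', b, hb', hab⟩
  have hd : dirs (insert v Ω) p = dirs Ω p := by
    by_cases hvp : v = p
    · subst hvp
      exact dirs_insert_self Ω v
    · rw [dirs_insert_of_ne Ω hvp, Finset.insert_eq_self]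
      obtain ⟨a, ha, hpos⟩ := exists_gp_pos_of_mem_hull hv (Ne.symm hvp)
      have hap : a ≠ p := by
        rintro rfl
        rw [gp_self_right] at hpos
        exact hpos.false
      exact mem_dirs.2 ⟨a, ha, hap, ((dir_eq_iff hT hap).2 hpos).symm⟩
  simp only [weight, hh, hd]

open Classical in
/-- Adding a point `v` outside the hull attaches a segment `[m, v]` to the hull. -/
theorem exists_weight_insert (hT : IsMetricTree T) {Ω : Finset T} (hΩ : Ω.Nonempty) {v : T}
    (hv : v ∉ hull Ω) : ∃ m ∈ hull Ω, ∀ p, weight (insert v Ω) p =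
      weight Ω p - (if p = m then 1 else 0) + (if p = v then 1 else 0) := by
  obtain ⟨⟨a, b⟩, hab, hmin⟩ := (Ω ×ˢ Ω).exists_min_image (fun x => gp v x.1 x.2)
    (hΩ.product hΩ)
  simp only [Finset.mem_product] at hab hmin
  obtain ⟨ha, hb⟩ := hab
  replace hmin : ∀ c ∈ Ω, ∀ d ∈ Ω, gp v a b ≤ gp v c d := fun c hc d hd => hmin (c, d) ⟨hc, hd⟩
  have hpos : 0 < gp v a b := (gp_nonneg _ _ _).lt_of_ne fun h => hv ⟨a, ha, b, hb, h.symm⟩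
  obtain ⟨ρ, hρ⟩ : ∃ ρ, gp v a b = 2 * ρ := ⟨gp v a b / 2, by ring⟩
  rw [hρ] at hpos hmin
  have hle : ρ ≤ dist v a := by
    have := dist_triangle v a b
    unfold gp at hρ
    linarith
  obtain ⟨m, hvm, hma⟩ := hT.geodesic v a ρ (by linarith) hle
  have hmu : ∀ u ∈ Ω, dist m u = dist v u - ρ := by
    intro u hu
    have h1 := hT.four_point m u v a
    have h2 := hmin u hu a ha
    have h3 := dist_triangle v m u
    unfold gp at h2
    rw [dist_comm m v, hvm, hma, dist_comm u v] at h1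
    rcases le_max_iff.1 h1 with h | h <;> linarith
  have hgm : ∀ u ∈ Ω, gp m v u = 0 := fun u hu => by
    rw [gp, hmu u hu, dist_comm m v, hvm]
    ring
  have hmh : m ∈ hull Ω := ⟨a, ha, b, hb, by
    rw [gp, hmu a ha, hmu b hb]
    unfold gp at hρ
    linarith⟩
  have hmv : v ≠ m := by
    rintro rfl
    exact hv hmh
  have hvΩ : v ∉ Ω := fun h => hv (subset_hull h)
  refine ⟨m, hmh, fun p => ?_⟩
  by_cases hpv : p = v
  · subst hpv
    rw [weight_of_notMem hv, weight_of_mem (subset_hull (Finset.mem_insert_self _ _)),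
      dirs_insert_self, card_dirs_of_notMem_hull hT hΩ hv]
    simp [hmv]
  rw [if_neg hpv]
  by_cases hpm : p = m
  · subst hpm
    rw [weight_of_mem hmh, weight_of_mem (hull_mono (Finset.subset_insert _ _) hmh),
      dirs_insert_of_ne Ω hmv, Finset.card_insert_of_notMem]
    · push_cast
      simp only [if_true]
      ring
    · intro h
      obtain ⟨u, hu, hup, e⟩ := mem_dirs.1 h
      have := (dir_eq_iff hT hmv).1 e
      rw [gp_comm, hgm u hu] at this
      exact this.false
  rw [if_neg hpm]
  by_cases hp : p ∈ hull Ω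
  · rw [weight_of_mem hp, weight_of_mem (hull_mono (Finset.subset_insert _ _) hp),
      dirs_insert_of_ne Ω (Ne.symm hpv), Finset.insert_eq_self.2]
    · ring
    obtain ⟨c, hc, hpos'⟩ := exists_gp_pos_of_mem_hull hmh hpm
    have hcp : c ≠ p := by
      rintro rfl
      rw [gp_self_right] at hpos'
      exact hpos'.false
    refine mem_dirs.2 ⟨c, hc, hcp, ((dir_eq_iff hT hcp).2 (gp_pos_trans hT ?_ hpos')).symm⟩
    refine (gp_nonneg _ _ _).lt_of_ne fun h => ?_
    obtain ⟨x, hx, y, hy, hxy⟩ := hp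
    have h1 := hmin x hx y hy
    have h2 := dist_triangle v p x
    have h3 := dist_triangle v p y
    have h4 := dist_pos.2 hpm
    unfold gp at h h1 hxy
    rw [dist_comm p v, hvm] at h
    linarith
  · rw [weight_of_notMem hp]
    by_cases hp' : p ∈ hull (insert v Ω)
    · rw [weight_of_mem hp', dirs_insert_of_ne Ω (Ne.symm hpv), Finset.card_insert_of_notMem,
        card_dirs_of_notMem_hull hT hΩ hp]
      · simp
      have hex : ∃ u ∈ Ω, gp p v u = 0 := by
        obtain ⟨x, hx, y, hy, hxy⟩ := hp'
        rcases Finset.mem_insert.1 hx with ex | hx' <;> rcases Finset.mem_insert.1 hy with ey | hy'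
        · rw [ex, ey, gp_same] at hxy
          exact absurd (dist_eq_zero.1 (by linarith)) hpv
        · exact ⟨y, hy', by rwa [← ex]⟩
        · exact ⟨x, hx', by rwa [gp_comm, ← ey]⟩
        · exact absurd ⟨x, hx', y, hy', hxy⟩ hp
      obtain ⟨u, hu, hpu⟩ := hex
      intro h
      obtain ⟨c, hc, hcp, e⟩ := mem_dirs.1 h
      have h1 := (dir_eq_iff hT (Ne.symm hpv)).1 e
      have h2 : 0 < gp p c u := (gp_nonneg _ _ _).lt_of_ne fun h => hp ⟨c, hc, u, hu, h.symm⟩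
      rw [gp_comm] at h1
      exact (gp_pos_trans hT h1 h2).ne' hpu
    · rw [weight_of_notMem hp']
      rfl

/-- The Euler characteristic of the hull of a finite set is one. -/
theorem exists_sum_weight_eq_two (hT : IsMetricTree T) {Ω : Finset T} (hΩ : Ω.Nonempty) :
    ∃ S₀ : Finset T, (∀ p ∈ S₀, p ∈ hull Ω) ∧ ∀ S, S₀ ⊆ S → ∑ p ∈ S, weight Ω p = 2 := by
  classical
  induction hΩ using Finset.Nonempty.cons_induction with
  | singleton a =>
    refine ⟨{a}, fun p hp => subset_hull hp, fun S hS => ?_⟩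
    have : ∀ p, weight {a} p = if p = a then 2 else 0 := by
      intro p
      by_cases hp : p = a
      · subst hp
        rw [weight_of_mem (subset_hull (by simp))]
        simp [dirs]
      · rw [weight_of_notMem, if_neg hp]
        rintro ⟨u, hu, v, hv, h⟩
        obtain rfl := Finset.mem_singleton.1 hu
        obtain rfl := Finset.mem_singleton.1 hv
        rw [gp_same] at h
        exact hp (dist_eq_zero.1 (by linarith))
    simp only [this, Finset.sum_ite_eq']
    simpa using hS
  | cons v Ω hv hΩ ih =>
    obtain ⟨S₀, hS₀, hsum⟩ := ih
    rw [Finset.cons_eq_insert]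
    have hmono := hull_mono (Finset.subset_insert v Ω)
    by_cases hvh : v ∈ hull Ω
    · refine ⟨S₀, fun p hp => hmono (hS₀ p hp), fun S hS => ?_⟩
      simp only [weight_insert_of_mem_hull hT hvh, hsum S hS]
    · obtain ⟨m, hm, hw⟩ := exists_weight_insert hT hΩ hvh
      refine ⟨insert v (insert m S₀), ?_, fun S hS => ?_⟩
      · simp only [Finset.mem_insert, forall_eq_or_imp]
        exact ⟨subset_hull (by simp), hmono hm, fun p hp => hmono (hS₀ p hp)⟩
      · rw [Finset.insert_subset_iff, Finset.insert_subset_iff] at hS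
        simp only [hw, Finset.sum_add_distrib, Finset.sum_sub_distrib, Finset.sum_ite_eq',
          hS.1, hS.2.1, if_true, hsum S hS.2.2]
        norm_num

end MetricTree

/-! ### Free groups acting on metric trees -/

theorem FreeGroupBasis.closure_range_eq_top {ι G : Type*} [Group G] (b : FreeGroupBasis ι G) :
    Subgroup.closure (Set.range b) = ⊤ := by
  let f : G →* Subgroup.closure (Set.range b) :=
    b.lift fun i => ⟨b i, Subgroup.subset_closure ⟨i, rfl⟩⟩
  have h : (Subgroup.closure (Set.range b)).subtype.comp f = MonoidHom.id G :=
    b.ext_hom _ _ fun i => by simp [f]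
  refine (Subgroup.eq_top_iff' _).2 fun g => ?_
  have := (f g).2
  rwa [show ((f g : Subgroup.closure (Set.range b)) : G) = g from DFunLike.congr_fun h g] at this

/-- The edges of the Cayley graph of a group with both endpoints in `S`. -/
noncomputable def cayleyEdges {ι G : Type*} [Group G] [Fintype ι] (x : ι → G) (S : Finset G) :
    Finset (G × ι) := by
  classical exact (S ×ˢ Finset.univ).filter fun e => x e.2 * e.1 ∈ S

theorem mem_cayleyEdges {ι G : Type*} [Group G] [Fintype ι] {x : ι → G} {S : Finset G}
    {e : G × ι} : e ∈ cayleyEdges x S ↔ e.1 ∈ S ∧ x e.2 * e.1 ∈ S := by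
  simp [cayleyEdges]

/-- Every finite subset of a finitely generated group is contained in a finite connected
subgraph of the Cayley graph. -/
theorem FreeGroupBasis.exists_connected_finset {ι G : Type*} [Group G] [Fintype ι]
    (b : FreeGroupBasis ι G) (B : Finset G) :
    ∃ S : Finset G, 1 ∈ S ∧ B ⊆ S ∧
      GraphLinked (fun e : G × ι => e.1) (fun e => b e.2 * e.1) (cayleyEdges b S) S 1 := by
  classical
  let Good : Finset G → Prop := fun S => 1 ∈ S ∧
      GraphLinked (fun e : G × ι => e.1) (fun e => b e.2 * e.1) (cayleyEdges b S) S 1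
  have hmono : ∀ {S S' : Finset G}, S ⊆ S' → cayleyEdges b S ⊆ cayleyEdges b S' := by
    intro S S' h e he
    rw [mem_cayleyEdges] at he ⊢
    exact ⟨h he.1, h he.2⟩
  have hone : Good {1} := by
    refine ⟨by simp, fun C h0 _ v hv => ?_⟩
    rwa [Finset.mem_singleton.1 hv]
  have hunion : ∀ S S', Good S → Good S' → Good (S ∪ S') := by
    intro S S' h h'
    refine ⟨by simp [h.1], fun C h0 hC v hv => ?_⟩
    rcases Finset.mem_union.1 hv with hv | hv
    · exact h.2 C h0 (fun e he => hC e (hmono Finset.subset_union_left he)) v hv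
    · exact h'.2 C h0 (fun e he => hC e (hmono Finset.subset_union_right he)) v hv
  have hex : ∀ g : G, ∃ S, Good S ∧ g ∈ S := by
    intro g
    have hg : g ∈ Subgroup.closure (Set.range b) := by simp [b.closure_range_eq_top]
    induction hg using Subgroup.closure_induction_left with
    | one => exact ⟨{1}, hone, by simp⟩
    | mul_left x hx y _ ih =>
      obtain ⟨i, rfl⟩ := hx
      obtain ⟨S, hS, hy⟩ := ih
      refine ⟨insert (b i * y) S, ⟨by simp [hS.1], fun C h0 hC v hv => ?_⟩, by simp⟩
      have h1 := hS.2 C h0 fun e he => hC e (hmono (Finset.subset_insert _ _) he)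
      rcases Finset.mem_insert.1 hv with rfl | hv
      · exact (hC (y, i) (mem_cayleyEdges.2 ⟨by simp [hy], by simp⟩)).1 (h1 y hy)
      · exact h1 v hv
    | inv_mul_cancel x hx y _ ih =>
      obtain ⟨i, rfl⟩ := hx
      obtain ⟨S, hS, hy⟩ := ih
      refine ⟨insert ((b i)⁻¹ * y) S, ⟨by simp [hS.1], fun C h0 hC v hv => ?_⟩, by simp⟩
      have h1 := hS.2 C h0 fun e he => hC e (hmono (Finset.subset_insert _ _) he)
      rcases Finset.mem_insert.1 hv with rfl | hv
      · refine (hC ((b i)⁻¹ * y, i) (mem_cayleyEdges.2 ⟨by simp, by simp [hy]⟩)).2 ?_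
        simpa using h1 y hy
      · exact h1 v hv
  suffices ∃ S, Good S ∧ B ⊆ S by
    obtain ⟨S, hS, hB⟩ := this
    exact ⟨S, hS.1, hB, hS.2⟩
  induction B using Finset.induction_on with
  | empty => exact ⟨{1}, hone, by simp⟩
  | insert g B _ ih =>
    obtain ⟨S, hS, hB⟩ := ih
    obtain ⟨S', hS', hg⟩ := hex g
    exact ⟨S ∪ S', hunion S S' hS hS', Finset.insert_subset (by simp [hg])
      (hB.trans Finset.subset_union_left)⟩

namespace MetricTree

open scoped Pointwise

variable {T K : Type*} [MetricSpace T] [Group K] [MulAction K T]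

theorem gp_smul (hiso : ∀ (g : K) (p q : T), dist (g • p) (g • q) = dist p q) (g : K)
    (p u v : T) : gp (g • p) (g • u) (g • v) = gp p u v := by
  simp only [gp, hiso]

theorem smul_dir (hiso : ∀ (g : K) (p q : T), dist (g • p) (g • q) = dist p q) (g : K)
    (p u : T) : g • dir p u = dir (g • p) (g • u) := by
  ext w
  rw [Set.mem_smul_set_iff_inv_smul_mem]
  change 0 < gp p u (g⁻¹ • w) ↔ 0 < gp (g • p) (g • u) w
  rw [← gp_smul hiso g p u, smul_inv_smul]

theorem smul_mem_hull (hiso : ∀ (g : K) (p q : T), dist (g • p) (g • q) = dist p q) (g : K)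
    {Ω Ω' : Finset T} (h : ∀ u ∈ Ω, g • u ∈ Ω') {p : T} (hp : p ∈ hull Ω) : g • p ∈ hull Ω' := by
  obtain ⟨u, hu, v, hv, e⟩ := hp
  exact ⟨g • u, h u hu, g • v, h v hv, by rw [gp_smul hiso, e]⟩

theorem smul_mem_dirs (hiso : ∀ (g : K) (p q : T), dist (g • p) (g • q) = dist p q) (g : K)
    {Ω Ω' : Finset T} (h : ∀ u ∈ Ω, g • u ∈ Ω') {p : T} {δ : Set T} (hδ : δ ∈ dirs Ω p) :
    g • δ ∈ dirs Ω' (g • p) := by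
  obtain ⟨u, hu, hup, rfl⟩ := mem_dirs.1 hδ
  exact mem_dirs.2 ⟨g • u, h u hu, fun e => hup (smul_left_cancel g e), (smul_dir hiso g p u).symm⟩

theorem card_dirs_le_smul (hiso : ∀ (g : K) (p q : T), dist (g • p) (g • q) = dist p q) (g : K)
    {Ω Ω' : Finset T} (h : ∀ u ∈ Ω, g • u ∈ Ω') (p : T) :
    (dirs Ω p).card ≤ (dirs Ω' (g • p)).card :=
  Finset.card_le_card_of_injOn (g • ·) (fun _ hδ => smul_mem_dirs hiso g h hδ)
    fun _ _ _ _ e => smul_left_cancel g e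

/-- Points at the same distance from `p` on two segments with a long common initial segment
coincide. -/
theorem eq_of_two_mul_le_gp (hT : IsMetricTree T) {p u u' q q' : T} {r : ℝ}
    (h : 2 * r ≤ gp p u u') (hq : dist p q = r) (hqu : dist q u = dist p u - r)
    (hq' : dist p q' = r) (hqu' : dist q' u' = dist p u' - r) : q = q' := by
  have h1 : gp p q u = 2 * r := by rw [gp, hq, hqu]; ring
  have h2 : gp p u' q' = 2 * r := by rw [gp, hq', dist_comm u', hqu']; ring
  have h3 := min_gp_le hT p u q' u'
  have h4 := min_gp_le hT p q q' u
  rw [h2, min_eq_right h] at h3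
  rw [h1] at h4
  have h5 := (le_min le_rfl h3).trans h4
  unfold gp at h5
  exact dist_le_zero.1 (by linarith)

/-- The stabilizer of a direction is abelian if stabilizers of nondegenerate segments are. -/
theorem commute_of_smul_dir_eq (hT : IsMetricTree T)
    (hiso : ∀ (g : K) (p q : T), dist (g • p) (g • q) = dist p q)
    (hab : ∀ (p q : T) (g h : K), p ≠ q → g • p = p → g • q = q → h • p = p → h • q = q →
      g * h = h * g) {p u : T} (hup : u ≠ p) {g h : K} (hgp : g • p = p)
    (hgu : g • dir p u = dir p u) (hhp : h • p = p) (hhu : h • dir p u = dir p u) :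
    g * h = h * g := by
  have key : ∀ k : K, k • p = p → k • dir p u = dir p u → 0 < gp p u (k • u) := by
    intro k hk hku
    rw [smul_dir hiso, hk] at hku
    exact (dir_eq_iff hT fun e => hup (smul_left_cancel k (e.trans hk.symm))).1 hku.symm
  have hg := key g hgp hgu
  have hh := key h hhp hhu
  have hle : ∀ k : K, k • p = p → gp p u (k • u) / 2 ≤ dist p u := by
    intro k hk
    have h1 : dist p (k • u) = dist p u := by conv_lhs => rw [← hk, hiso]
    have h2 : 0 ≤ dist u (k • u) := dist_nonneg
    rw [gp, h1]
    linarith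
  obtain ⟨q, hpq, hqu⟩ := hT.geodesic p u (min (gp p u (g • u)) (gp p u (h • u)) / 2)
    (by have := lt_min hg hh; linarith)
    (by have := min_le_left (gp p u (g • u)) (gp p u (h • u)); have := hle g hgp; linarith)
  have hfix : ∀ k : K, k • p = p →
      min (gp p u (g • u)) (gp p u (h • u)) ≤ gp p u (k • u) → k • q = q := by
    intro k hk hmin
    refine (eq_of_two_mul_le_gp hT (u' := k • u) (by linarith) hpq hqu ?_ ?_).symm
    · conv_lhs => rw [← hk, hiso, hpq]
    · have h1 : dist p (k • u) = dist p u := by conv_lhs => rw [← hk, hiso]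
      rw [hiso, hqu, h1]
  refine hab p q g h ?_ hgp (hfix g hgp (min_le_left _ _)) hhp (hfix h hhp (min_le_right _ _))
  rintro rfl
  rw [dist_self] at hpq
  have := lt_min hg hh
  linarith

theorem sum_card_dirs_le {ι : Type*} (b : FreeGroupBasis ι K) (hT : IsMetricTree T)
    (hiso : ∀ (g : K) (p q : T), dist (g • p) (g • q) = dist p q)
    (hab : ∀ (p q : T) (g h : K), p ≠ q → g • p = p → g • q = q → h • p = p → h • q = q →
      g * h = h * g) {Ω : Finset T} {Ωi : ι → Finset T} (hsub : ∀ i, Ωi i ⊆ Ω)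
    (hsmul : ∀ i, ∀ u ∈ Ωi i, b i • u ∈ Ω) (V : Finset T) (E : Finset (T × ι))
    (hE : ∀ e ∈ E, e.1 ∈ V ∧ b e.2 • e.1 ∈ V) :
    ∑ e ∈ E, (dirs (Ωi e.2) e.1).card ≤ ∑ v ∈ V, (dirs Ω v).card := by
  classical
  have h := b.card_edges_le (Y := T × Set T)
    ((V.sigma fun v => dirs Ω v).image fun x => (x.1, x.2))
    ((E.sigma fun e => dirs (Ωi e.2) e.1).image fun x => ((x.1.1, x.2), x.1.2)) ?_ ?_
  · rwa [Finset.card_image_of_injective, Finset.card_image_of_injective, Finset.card_sigma,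
      Finset.card_sigma] at h
    · rintro ⟨v, δ⟩ ⟨v', δ'⟩ h
      simpa using h
    · rintro ⟨⟨v, i⟩, δ⟩ ⟨⟨v', i'⟩, δ'⟩ h
      simp only [Prod.mk.injEq] at h
      obtain ⟨⟨rfl, rfl⟩, rfl⟩ := h
      rfl
  · intro e he
    obtain ⟨⟨⟨p, i⟩, δ⟩, hx, rfl⟩ := Finset.mem_image.1 he
    rw [Finset.mem_sigma] at hx
    have hp := hE (p, i) hx.1
    exact ⟨Finset.mem_image.2 ⟨⟨p, δ⟩, Finset.mem_sigma.2 ⟨hp.1, dirs_mono (hsub i) p hx.2⟩, rfl⟩,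
      Finset.mem_image.2 ⟨⟨b i • p, b i • δ⟩, Finset.mem_sigma.2
        ⟨hp.2, smul_mem_dirs hiso (b i) (hsmul i) hx.2⟩, rfl⟩⟩
  · intro y hy g h hg hh
    obtain ⟨⟨p, δ⟩, hx, rfl⟩ := Finset.mem_image.1 hy
    obtain ⟨u, -, hup, hδ⟩ := mem_dirs.1 (Finset.mem_sigma.1 hx).2
    simp only [Prod.smul_mk, Prod.mk.injEq] at hg hh hup hδ
    rw [← hδ] at hg hh
    exact commute_of_smul_dir_eq hT hiso hab hup hg.1 hg.2 hh.1 hh.2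

/-- Finitely many elements fixing a point `o` of a tree lie in a subgroup of the stabilizer of `o`
generated by no more elements than the acting free group. -/
theorem exists_stabilizer_generators {ι : Type*} [Fintype ι] (b : FreeGroupBasis ι K)
    (hT : IsMetricTree T) (hiso : ∀ (g : K) (p q : T), dist (g • p) (g • q) = dist p q)
    (hab : ∀ (p q : T) (g h : K), p ≠ q → g • p = p → g • q = q → h • p = p → h • q = q →
      g * h = h * g) (o : T) (B : Finset K) (hB : ∀ g ∈ B, g • o = o) :
    ∃ s : Finset K, s.card ≤ Fintype.card ι ∧ (∀ g ∈ s, g • o = o) ∧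
      (B : Set K) ⊆ Subgroup.closure (s : Set K) := by
  classical
  obtain ⟨S, h1S, hBS, hlink⟩ := b.exists_connected_finset (B ∪ Finset.univ.image b)
  have hbS : ∀ i, b i ∈ S := fun i => hBS (by simp)
  set Ω : Finset T := S.image (· • o) with hΩ
  set Ωi : ι → Finset T := fun i => (S.filter fun g => b i * g ∈ S).image (· • o) with hΩi
  have hsub : ∀ i, Ωi i ⊆ Ω := fun i => Finset.image_subset_image (Finset.filter_subset _ _)
  have hsmul : ∀ i, ∀ u ∈ Ωi i, b i • u ∈ Ω := by
    intro i u hu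
    obtain ⟨g, hg, rfl⟩ := Finset.mem_image.1 hu
    exact Finset.mem_image.2 ⟨b i * g, (Finset.mem_filter.1 hg).2, mul_smul _ _ _⟩
  have hoΩ : o ∈ Ω := Finset.mem_image.2 ⟨1, h1S, one_smul _ _⟩
  have hoi : ∀ i, o ∈ Ωi i := fun i =>
    Finset.mem_image.2 ⟨1, Finset.mem_filter.2 ⟨h1S, by simpa using hbS i⟩, one_smul _ _⟩
  obtain ⟨S₀, hS₀, hsum₀⟩ := exists_sum_weight_eq_two hT ⟨o, hoΩ⟩
  choose Si hSi hsumi using fun i => exists_sum_weight_eq_two hT ⟨o, hoi i⟩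
  set P : Finset T := Ω ∪ S₀ ∪ Finset.univ.biUnion (fun i => Si i ∪ (Si i).image (b i • ·)) with hP
  have hΩP : Ω ⊆ P := fun p hp => by simp [hP, hp]
  have hS₀P : S₀ ⊆ P := fun p hp => by simp [hP, hp]
  have hSiP : ∀ i, Si i ⊆ P := fun i p hp => by
    simp only [hP, Finset.mem_union, Finset.mem_biUnion]
    exact Or.inr ⟨i, Finset.mem_univ i, Or.inl hp⟩
  have hSiP' : ∀ i, ∀ p ∈ Si i, b i • p ∈ P := fun i p hp => by
    simp only [hP, Finset.mem_union, Finset.mem_biUnion]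
    exact Or.inr ⟨i, Finset.mem_univ i, Or.inr (Finset.mem_image_of_mem _ hp)⟩
  have hPh : ∀ p ∈ P, p ∈ hull Ω := by
    intro p hp
    simp only [hP, Finset.mem_union, Finset.mem_biUnion, Finset.mem_univ, true_and,
      Finset.mem_image] at hp
    rcases hp with (hp | hp) | ⟨i, hp | ⟨q, hq, rfl⟩⟩
    · exact subset_hull hp
    · exact hS₀ p hp
    · exact hull_mono (hsub i) (hSi i p hp)
    · exact smul_mem_hull hiso (b i) (hsmul i) (hSi i q hq)
  set E : Finset (T × ι) := (P ×ˢ Finset.univ).filter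
    (fun e => e.1 ∈ hull (Ωi e.2) ∧ b e.2 • e.1 ∈ P) with hEdef
  have hmE : ∀ e, e ∈ E ↔ e.1 ∈ P ∧ e.1 ∈ hull (Ωi e.2) ∧ b e.2 • e.1 ∈ P := by
    intro e
    simp [hEdef]
  have hE : ∀ e ∈ E, e.1 ∈ P ∧ b e.2 • e.1 ∈ P := fun e he =>
    ⟨((hmE e).1 he).1, ((hmE e).1 he).2.2⟩
  have hsumP : ∑ p ∈ P, (2 - ((dirs Ω p).card : ℤ)) = 2 := by
    rw [← Finset.sum_congr rfl fun p hp => weight_of_mem (hPh p hp)]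
    exact hsum₀ P hS₀P
  have hsumE : ∑ e ∈ E, (2 - ((dirs (Ωi e.2) e.1).card : ℤ)) = 2 * Fintype.card ι := by
    rw [hEdef, Finset.sum_filter, Finset.sum_product_right]
    have : ∀ i, ∑ p ∈ P, (if p ∈ hull (Ωi i) ∧ b i • p ∈ P then
        (2 - ((dirs (Ωi i) p).card : ℤ)) else 0) = 2 := by
      intro i
      rw [← Finset.sum_filter,
        ← Finset.sum_congr rfl fun p hp => weight_of_mem (Finset.mem_filter.1 hp).2.1]
      exact hsumi i _ fun p hp => Finset.mem_filter.2 ⟨hSiP i hp, hSi i p hp, hSiP' i p hp⟩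
    simp only [this, Finset.sum_const, Finset.card_univ, nsmul_eq_mul]
    ring
  obtain ⟨V₁, hV₁, E₁, hE₁, ho₁, hok₁, hlink₁, hout₁⟩ := exists_graphComponent
    (fun e : T × ι => e.1) (fun e => b e.2 • e.1) E P hE (hΩP hoΩ)
  have hedge : ∀ e ∈ cayleyEdges b S, ((e.1 • o, e.2) : T × ι) ∈ E := by
    intro e he
    rw [mem_cayleyEdges] at he
    have h1 : e.1 • o ∈ Ωi e.2 :=
      Finset.mem_image.2 ⟨e.1, Finset.mem_filter.2 ⟨he.1, he.2⟩, rfl⟩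
    exact (hmE _).2 ⟨hΩP (hsub _ h1), subset_hull h1, hΩP (hsmul _ _ h1)⟩
  have hSV : ∀ g ∈ S, g • o ∈ V₁ := by
    refine hlink (fun g => g • o ∈ V₁) (by simpa using ho₁) fun e he => ?_
    rw [mul_smul]
    by_cases h : ((e.1 • o, e.2) : T × ι) ∈ E₁
    · exact iff_of_true (hok₁ _ h).1 (hok₁ _ h).2
    · exact iff_of_false (hout₁ _ (hedge e he) h).1 (hout₁ _ (hedge e he) h).2
  have hΩV : Ω ⊆ V₁ := fun p hp => by
    obtain ⟨g, hg, rfl⟩ := Finset.mem_image.1 hp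
    exact hSV g hg
  have hrest : ∑ v ∈ P \ V₁, (2 - ((dirs Ω v).card : ℤ)) ≤
      ∑ e ∈ E \ E₁, (2 - ((dirs (Ωi e.2) e.1).card : ℤ)) := by
    refine sum_le_sum_of_connected (fun e : T × ι => e.1) (fun e => b e.2 • e.1) _ _ _ _ ?_ ?_
    · intro e he
      rw [Finset.mem_sdiff] at he
      simp [hE e he.1, hout₁ e he.1 he.2]
    intro V₂ hV₂ E₂ hE₂ v₀ hv₀ hok₂ hlink₂
    obtain ⟨Tr, hTr, -, child, hcard, -, -, -, hinj, hchild⟩ :=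
      hlink₂.exists_spanningTree hv₀ hok₂ fun _ => (1 : K)
    simp only [Finset.sum_sub_distrib, Finset.sum_const, nsmul_eq_mul]
    by_cases hTE : Tr = E₂
    · subst hTE
      have h1 : ∑ e ∈ Tr, (dirs (Ωi e.2) e.1).card ≤ ∑ e ∈ Tr, (dirs Ω (child e)).card := by
        refine Finset.sum_le_sum fun e he => ?_
        rcases (hchild e he).2.2 with h | h <;> rw [h]
        · exact Finset.card_le_card (dirs_mono (hsub _) _)
        · exact card_dirs_le_smul hiso _ (hsmul _) _
      have h2 : ∑ e ∈ Tr, (dirs Ω (child e)).card ≤ ∑ v ∈ V₂.erase v₀, (dirs Ω v).card := by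
        rw [← Finset.sum_image (f := fun v => (dirs Ω v).card) hinj]
        refine Finset.sum_le_sum_of_subset fun v hv => ?_
        obtain ⟨e, he, rfl⟩ := Finset.mem_image.1 hv
        exact Finset.mem_erase.2 ⟨(hchild e he).2.1, (hchild e he).1⟩
      have h3 := Finset.add_sum_erase V₂ (fun v => (dirs Ω v).card) hv₀
      have h4 : 2 ≤ (dirs Ω v₀).card := by
        have := Finset.mem_sdiff.1 (hV₂ hv₀)
        exact two_le_card_dirs hT (hPh _ this.1) fun h => this.2 (hΩV h)
      zify at h1 h2 h3 h4 hcard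
      linarith
    · have h1 : Tr.card < E₂.card := Finset.card_lt_card (hTr.ssubset_of_ne hTE)
      have h2 := sum_card_dirs_le b hT hiso hab hsub hsmul V₂ E₂ hok₂
      have h3 : V₂.card ≤ E₂.card := by omega
      zify at h2 h3
      linarith
  obtain ⟨Tr, hTr, k, -, hcard, hTl, hk0, hk, -⟩ :=
    hlink₁.exists_spanningTree ho₁ hok₁ fun e => b e.2
  have hkv : ∀ v ∈ V₁, k v • o = v := by
    refine hTl (fun v => k v • o = v) (by simp [hk0]) fun g hg => ?_
    simp only [hk g hg, mul_smul, smul_left_cancel_iff]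
  have hcard' : (E₁ \ Tr).card ≤ Fintype.card ι := by
    have h1 := sum_card_dirs_le b hT hiso hab hsub hsmul V₁ E₁ hok₁
    rw [← Finset.sum_sdiff hV₁] at hsumP
    rw [← Finset.sum_sdiff hE₁] at hsumE
    simp only [Finset.sum_sub_distrib, Finset.sum_const, nsmul_eq_mul] at hsumP hsumE hrest
    have h2 := Finset.card_sdiff_add_card_eq_card hTr
    zify at h1 h2 hcard ⊢
    linarith
  refine ⟨(E₁ \ Tr).image fun e => (k (b e.2 • e.1))⁻¹ * (b e.2 * k e.1),
    Finset.card_image_le.trans hcard', ?_, ?_⟩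
  · intro g hg
    obtain ⟨e, he, rfl⟩ := Finset.mem_image.1 hg
    have he := hok₁ e (Finset.mem_sdiff.1 he).1
    rw [mul_smul, mul_smul, hkv _ he.1, inv_smul_eq_iff, hkv _ he.2]
  · set Q := Subgroup.closure
      (((E₁ \ Tr).image fun e => (k (b e.2 • e.1))⁻¹ * (b e.2 * k e.1) : Finset K) : Set K) with hQ
    have hγ : ∀ e ∈ E₁, (k (b e.2 • e.1))⁻¹ * (b e.2 * k e.1) ∈ Q := by
      intro e he
      by_cases h : e ∈ Tr
      · rw [hk e h, inv_mul_cancel]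
        exact one_mem _
      · exact Subgroup.subset_closure (Finset.mem_coe.2
          (Finset.mem_image.2 ⟨e, Finset.mem_sdiff.2 ⟨he, h⟩, rfl⟩))
    have hall : ∀ g ∈ S, (k (g • o))⁻¹ * g ∈ Q := by
      refine hlink (fun g => (k (g • o))⁻¹ * g ∈ Q) (by simp [hk0]) fun e he => ?_
      have he₁ : ((e.1 • o, e.2) : T × ι) ∈ E₁ := by
        by_contra h
        exact (hout₁ _ (hedge e he) h).1 (hSV _ (mem_cayleyEdges.1 he).1)
      have h := hγ _ he₁
      rw [mul_smul, show (k (b e.2 • e.1 • o))⁻¹ * (b e.2 * e.1) =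
        ((k (b e.2 • e.1 • o))⁻¹ * (b e.2 * k (e.1 • o))) * ((k (e.1 • o))⁻¹ * e.1) by group]
      exact (Subgroup.mul_mem_cancel_left Q h).symm
    intro g hg
    have := hall g (hBS (Finset.mem_union_left _ hg))
    rwa [hB g hg, hk0, inv_one, one_mul] at this

end MetricTree

section CommonPrefix

variable {β : Type*} [DecidableEq β]

/-- The length of the longest common prefix of two lists. -/
def commonPrefixLength : List β → List β → ℕ
  | a :: l, b :: m => if a = b then commonPrefixLength l m + 1 else 0
  | _, _ => 0

theorem commonPrefixLength_comm (l m : List β) :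
    commonPrefixLength l m = commonPrefixLength m l := by
  induction l generalizing m with
  | nil => cases m <;> simp [commonPrefixLength]
  | cons a l ih =>
    cases m with
    | nil => simp [commonPrefixLength]
    | cons b m => simp [commonPrefixLength, ih m, eq_comm]

theorem min_commonPrefixLength_le (l m k : List β) :
    min (commonPrefixLength l m) (commonPrefixLength m k) ≤ commonPrefixLength l k := by
  induction l generalizing m k with
  | nil => simp [commonPrefixLength]
  | cons a l ih =>
    cases m with
    | nil => simp [commonPrefixLength]
    | cons b m =>
      cases k with
      | nil => simp [commonPrefixLength]
      | cons c k =>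
        have := ih m k
        simp only [commonPrefixLength]
        split_ifs <;> first | omega | (exfalso; simp_all)

end CommonPrefix

namespace FreeGroup

variable {α : Type*} [DecidableEq α]

theorem IsReduced.norm_mk {L : List (α × Bool)} (h : IsReduced L) : (mk L).norm = L.length := by
  rw [norm, toWord_mk, h.reduce_eq]

theorem IsReduced.invRev {L : List (α × Bool)} (h : IsReduced L) : IsReduced (invRev L) := by
  have : (mk L)⁻¹.toWord = FreeGroup.invRev L := by
    rw [toWord_inv, toWord_mk, h.reduce_eq]
  rw [← this]
  exact isReduced_toWord

theorem norm_inv_mk_mul_mk {L M : List (α × Bool)} (hL : IsReduced L) (hM : IsReduced M) :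
    ((mk L)⁻¹ * mk M).norm + 2 * commonPrefixLength L M = L.length + M.length := by
  induction L generalizing M with
  | nil =>
    simp only [← one_eq_mk, inv_one, one_mul, commonPrefixLength]
    simp [hM.norm_mk]
  | cons a L ih =>
    cases M with
    | nil =>
      simp only [← one_eq_mk, mul_one, norm_inv_eq, commonPrefixLength]
      simp [hL.norm_mk]
    | cons b M =>
      by_cases hab : a = b
      · subst hab
        have hL' : IsReduced L := List.IsChain.tail hL
        have hM' : IsReduced M := List.IsChain.tail hM
        have h1 : (mk (a :: L))⁻¹ * mk (a :: M) = (mk L)⁻¹ * mk M := by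
          have e1 : (mk (a :: L)) = mk [a] * mk L := by simp [mul_mk]
          have e2 : (mk (a :: M)) = mk [a] * mk M := by simp [mul_mk]
          rw [e1, e2]; group
        have := ih hL' hM'
        rw [h1]
        simp only [commonPrefixLength, if_true, List.length_cons]
        omega
      · have hred : IsReduced (FreeGroup.invRev (a :: L) ++ b :: M) := by
          refine List.isChain_append.2 ⟨hL.invRev, hM, ?_⟩
          intro x hx y hy hxy
          simp only [invRev, List.map_cons, List.reverse_cons, List.getLast?_append,
            List.getLast?_singleton, List.head?_cons, Option.mem_def, Option.some_or,
            Option.some.injEq] at hx hy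
          subst hx hy
          simp only at hxy ⊢
          by_contra h
          apply hab
          refine Prod.ext hxy ?_
          revert h
          cases a.2 <;> cases b.2 <;> simp
        rw [inv_mk, mul_mk, hred.norm_mk]
        simp [commonPrefixLength, hab]

theorem norm_inv_mul (g h : FreeGroup α) :
    (g⁻¹ * h).norm + 2 * commonPrefixLength g.toWord h.toWord = g.norm + h.norm := by
  have := norm_inv_mk_mul_mk (isReduced_toWord (x := g)) (isReduced_toWord (x := h))
  simp only [mk_toWord] at this
  exact this

/-- The word metric of a free group satisfies the four-point condition. -/
theorem norm_four_point (w x y z : FreeGroup α) :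
    (w⁻¹ * x).norm + (y⁻¹ * z).norm ≤
      max ((w⁻¹ * y).norm + (x⁻¹ * z).norm) ((w⁻¹ * z).norm + (x⁻¹ * y).norm) := by
  have key : ∀ a b : FreeGroup α, a⁻¹ * b = (w⁻¹ * a)⁻¹ * (w⁻¹ * b) := fun a b => by group
  rw [key y z, key x z, key x y]
  have h1 := norm_inv_mul (w⁻¹ * y) (w⁻¹ * z)
  have h2 := norm_inv_mul (w⁻¹ * x) (w⁻¹ * z)
  have h3 := norm_inv_mul (w⁻¹ * x) (w⁻¹ * y)
  have h4 := min_commonPrefixLength_le (w⁻¹ * y).toWord (w⁻¹ * x).toWord (w⁻¹ * z).toWord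
  rw [commonPrefixLength_comm (w⁻¹ * y).toWord (w⁻¹ * x).toWord] at h4
  omega

theorem exists_norm_eq (p q : FreeGroup α) {j : ℕ} (hj : j ≤ (p⁻¹ * q).norm) :
    ∃ m, (p⁻¹ * m).norm = j ∧ (m⁻¹ * q).norm = (p⁻¹ * q).norm - j := by
  set W := (p⁻¹ * q).toWord with hW
  have hred : IsReduced W := isReduced_toWord
  have hlen : W.length = (p⁻¹ * q).norm := rfl
  refine ⟨p * mk (W.take j), ?_, ?_⟩
  · rw [inv_mul_cancel_left, IsReduced.norm_mk (List.IsChain.take hred j),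
      List.length_take]
    omega
  · have : (p * mk (W.take j))⁻¹ * q = mk (W.drop j) := by
      have h2 : p⁻¹ * q = mk (W.take j) * mk (W.drop j) := by
        rw [mul_mk, List.take_append_drop, hW, mk_toWord]
      rw [mul_inv_rev, mul_assoc, h2]; group
    rw [this, IsReduced.norm_mk (List.IsChain.drop hred j), List.length_drop]
    omega

end FreeGroup

namespace FreeGroup

variable {α : Type*} [DecidableEq α]

theorem norm_inv_mul_comm (x y : FreeGroup α) : (x⁻¹ * y).norm = (y⁻¹ * x).norm := by
  rw [← norm_inv_eq]; simp

theorem norm_inv_mul_le (x y z : FreeGroup α) :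
    (x⁻¹ * z).norm ≤ (x⁻¹ * y).norm + (y⁻¹ * z).norm := by
  have : x⁻¹ * z = (x⁻¹ * y) * (y⁻¹ * z) := by group
  rw [this]
  exact norm_mul_le _ _

theorem norm_translate (g x y : FreeGroup α) : ((g * x)⁻¹ * (g * y)).norm = (x⁻¹ * y).norm := by
  congr 1; group

/-- An element which moves the ends of a long segment very little translates the middle part of
the segment along itself. -/
theorem exists_shift {p q z : FreeGroup α} {ε : ℕ} (hp : (p⁻¹ * (z * p)).norm ≤ ε)
    (hq : (q⁻¹ * (z * q)).norm ≤ ε) :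
    ∃ τ : ℤ, |τ| ≤ ε ∧ ∀ v, ((p⁻¹ * v).norm + (v⁻¹ * q).norm = (p⁻¹ * q).norm) →
      2 * ε < (p⁻¹ * v).norm → 2 * ε < (v⁻¹ * q).norm →
      ((p⁻¹ * (z * v)).norm : ℤ) = (p⁻¹ * v).norm + τ ∧
        (((z * v)⁻¹ * q).norm : ℤ) = (v⁻¹ * q).norm - τ := by
  refine ⟨((p⁻¹ * (z * q)).norm : ℤ) - (p⁻¹ * q).norm, ?_, fun v hv h1 h2 => ?_⟩
  · have t1 := norm_inv_mul_le p q (z * q)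
    have t2 := norm_inv_mul_le p (z * q) q
    rw [norm_inv_mul_comm (z * q) q] at t2
    rw [abs_le]
    omega
  · have a1 := norm_translate z p v
    have a2 := norm_translate z v q
    have a3 := norm_translate z p q
    have t1 := norm_inv_mul_le p q (z * q)
    have t2 := norm_inv_mul_le p (z * q) q
    have s1 := norm_inv_mul_comm (z * q) q
    have s2 := norm_inv_mul_comm (z * p) p
    have s3 := norm_inv_mul_comm (z * v) p
    have s4 := norm_inv_mul_comm (z * v) (z * p)
    have s5 := norm_inv_mul_comm (z * p) q
    have s6 := norm_inv_mul_comm q p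
    have s7 := norm_inv_mul_comm (z * q) p
    have s8 := norm_inv_mul_comm (z * q) (z * p)
    have t3 := norm_inv_mul_le (z * p) p (z * v)
    have t4 := norm_inv_mul_le (z * v) q (z * q)
    have t5 := norm_inv_mul_le q p (z * p)
    have t6 := norm_inv_mul_le (z * p) p q
    have t7 := norm_inv_mul_le p (z * p) q
    have f1 := norm_four_point (z * v) p (z * p) (z * q)
    have f2 := norm_four_point (z * v) (z * p) p (z * q)
    have g1 := norm_four_point (z * v) q (z * p) (z * q)
    have g2 := norm_four_point (z * v) (z * q) q (z * p)
    have k1 := norm_four_point p (z * q) q (z * p)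
    have k2 := norm_four_point p q (z * p) (z * q)
    have k3 := norm_four_point p q (z * q) (z * p)
    omega

/-- Two elements of a free group which move both ends of a sufficiently long segment very little
commute. -/
theorem commute_of_norm_le {p q z w : FreeGroup α} {ε : ℕ} (hzp : (p⁻¹ * (z * p)).norm ≤ ε)
    (hzq : (q⁻¹ * (z * q)).norm ≤ ε) (hwp : (p⁻¹ * (w * p)).norm ≤ ε)
    (hwq : (q⁻¹ * (w * q)).norm ≤ ε) (hlong : 8 * ε + 8 < (p⁻¹ * q).norm) : z * w = w * z := by
  obtain ⟨τ, hτ, hz⟩ := exists_shift hzp hzq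
  obtain ⟨σ, hσ, hw⟩ := exists_shift hwp hwq
  obtain ⟨v, hv1, hv2⟩ := exists_norm_eq p q (j := (p⁻¹ * q).norm / 2) (by omega)
  rw [abs_le] at hτ hσ
  obtain ⟨z1, z2⟩ := hz v (by omega) (by omega) (by omega)
  obtain ⟨w1, w2⟩ := hw v (by omega) (by omega) (by omega)
  obtain ⟨zw1, zw2⟩ := hz (w * v) (by omega) (by omega) (by omega)
  obtain ⟨wz1, wz2⟩ := hw (z * v) (by omega) (by omega) (by omega)
  have f := norm_four_point (z * (w * v)) (w * (z * v)) p q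
  have s1 := norm_inv_mul_comm (z * (w * v)) p
  have s2 := norm_inv_mul_comm (w * (z * v)) p
  have : ((z * (w * v))⁻¹ * (w * (z * v))).norm = 0 := by omega
  rw [norm_eq_zero, inv_mul_eq_one] at this
  rw [← mul_assoc, ← mul_assoc] at this
  exact mul_right_cancel this

end FreeGroup

section Ultralimit

open Topology

theorem exists_tendsto_hyperfilter {u : ℕ → ℝ} {C : ℝ} (h0 : ∀ n, 0 ≤ u n) (hC : ∀ n, u n ≤ C) :
    ∃ x, Tendsto u (hyperfilter ℕ) (𝓝 x) := by
  obtain ⟨x, -, hx⟩ := isCompact_Icc.ultrafilter_le_nhds (s := Set.Icc 0 C)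
    ((hyperfilter ℕ).map u) (by
      rw [le_principal_iff]
      exact Filter.mem_map.2 (Filter.univ_mem' fun n => ⟨h0 n, hC n⟩))
  exact ⟨x, hx⟩

variable {α : Type*} [DecidableEq α]

/-- The sequences in a free group whose norms grow at most linearly in the scaling sequence. -/
def boundedSeq (lam : ℕ → ℕ) : Subgroup (ℕ → FreeGroup α) where
  carrier := {p | ∃ C : ℕ, ∀ n, (p n).norm ≤ C * lam n}
  one_mem' := ⟨0, fun n => by simp⟩
  mul_mem' := by
    rintro p q ⟨C, hC⟩ ⟨D, hD⟩
    refine ⟨C + D, fun n => ?_⟩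
    have := FreeGroup.norm_mul_le (p n) (q n)
    have h1 := hC n
    have h2 := hD n
    rw [Pi.mul_apply, add_mul]
    omega
  inv_mem' := by
    rintro p ⟨C, hC⟩
    exact ⟨C, fun n => by simpa using hC n⟩

variable {lam : ℕ → ℕ}

/-- The rescaled distance between two bounded sequences at a given index. -/
noncomputable def scaledDist (p q : boundedSeq (α := α) lam) (n : ℕ) : ℝ :=
  (((p : ℕ → FreeGroup α) n)⁻¹ * (q : ℕ → FreeGroup α) n).norm / lam n

theorem scaledDist_nonneg (p q : boundedSeq (α := α) lam) (n : ℕ) : 0 ≤ scaledDist p q n := by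
  unfold scaledDist; positivity

theorem exists_scaledDist_tendsto (p q : boundedSeq (α := α) lam) :
    ∃ x, Tendsto (scaledDist p q) (hyperfilter ℕ) (𝓝 x) := by
  obtain ⟨C, hC⟩ := (p⁻¹ * q).2
  refine exists_tendsto_hyperfilter (C := C) (scaledDist_nonneg p q) fun n => ?_
  refine div_le_of_le_mul₀ (by positivity) (by positivity) ?_
  exact_mod_cast hC n

/-- The asymptotic pseudometric on bounded sequences. -/
noncomputable instance boundedSeqPseudoMetric : PseudoMetricSpace (boundedSeq (α := α) lam) where
  dist p q := limUnder (hyperfilter ℕ : Filter ℕ) (scaledDist p q)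
  dist_self p := by
    have : scaledDist p p = fun _ => 0 := by
      funext n; simp [scaledDist]
    rw [this]
    exact tendsto_const_nhds.limUnder_eq
  dist_comm p q := by
    congr 1
    funext n
    simp only [scaledDist]
    rw [FreeGroup.norm_inv_mul_comm]
  dist_triangle p q r := by
    refine le_of_tendsto_of_tendsto' (tendsto_nhds_limUnder (exists_scaledDist_tendsto p r))
      ((tendsto_nhds_limUnder (exists_scaledDist_tendsto p q)).add
        (tendsto_nhds_limUnder (exists_scaledDist_tendsto q r))) fun n => ?_
    simp only [scaledDist]
    rw [← add_div]
    gcongr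
    exact_mod_cast FreeGroup.norm_inv_mul_le _ _ _

theorem tendsto_scaledDist (p q : boundedSeq (α := α) lam) :
    Tendsto (scaledDist p q) (hyperfilter ℕ) (𝓝 (dist p q)) :=
  tendsto_nhds_limUnder (exists_scaledDist_tendsto p q)

theorem boundedSeq_dist_mul (g p q : boundedSeq (α := α) lam) :
    dist (g * p) (g * q) = dist p q := by
  refine tendsto_nhds_unique (tendsto_scaledDist _ _) ?_
  convert tendsto_scaledDist p q using 1
  funext n
  simp only [scaledDist, Subgroup.coe_mul, Pi.mul_apply]
  rw [FreeGroup.norm_translate]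

theorem isMetricTree_boundedSeq (hlam : Tendsto lam atTop atTop) :
    IsMetricTree (SeparationQuotient (boundedSeq (α := α) lam)) where
  four_point w x y z := by
    obtain ⟨w, rfl⟩ := SeparationQuotient.surjective_mk w
    obtain ⟨x, rfl⟩ := SeparationQuotient.surjective_mk x
    obtain ⟨y, rfl⟩ := SeparationQuotient.surjective_mk y
    obtain ⟨z, rfl⟩ := SeparationQuotient.surjective_mk z
    simp only [SeparationQuotient.dist_mk]
    refine le_of_tendsto_of_tendsto' ((tendsto_scaledDist w x).add (tendsto_scaledDist y z))
      (((tendsto_scaledDist w y).add (tendsto_scaledDist x z)).max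
        ((tendsto_scaledDist w z).add (tendsto_scaledDist x y))) fun n => ?_
    simp only [scaledDist, ← add_div]
    rw [max_div_div_right (by positivity)]
    gcongr
    exact_mod_cast FreeGroup.norm_four_point _ _ _ _
  geodesic p q r h0 hr := by
    obtain ⟨p, rfl⟩ := SeparationQuotient.surjective_mk p
    obtain ⟨q, rfl⟩ := SeparationQuotient.surjective_mk q
    rw [SeparationQuotient.dist_mk] at hr
    have key := fun n => FreeGroup.exists_norm_eq ((p : ℕ → FreeGroup α) n)
      ((q : ℕ → FreeGroup α) n) (j := min ⌊r * lam n⌋₊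
        ((((p : ℕ → FreeGroup α) n)⁻¹ * (q : ℕ → FreeGroup α) n).norm)) (min_le_right _ _)
    choose m hm1 hm2 using key
    have hmem : m ∈ boundedSeq (α := α) lam := by
      have : p⁻¹.1 * m ∈ boundedSeq (α := α) lam := by
        obtain ⟨C, hC⟩ := (p⁻¹ * q).2
        refine ⟨C, fun n => ?_⟩
        have h1 := hC n
        have h2 := hm1 n
        simp only [Subgroup.coe_mul, InvMemClass.coe_inv, Pi.mul_apply, Pi.inv_apply] at h1 ⊢
        omega
      exact (Subgroup.mul_mem_cancel_left _ p⁻¹.2).1 this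
    obtain ⟨m', hm'⟩ : ∃ m' : boundedSeq (α := α) lam, ∀ n, (m' : ℕ → FreeGroup α) n = m n :=
      ⟨⟨m, hmem⟩, fun _ => rfl⟩
    have hlam' : Tendsto (fun n => (lam n : ℝ)) (hyperfilter ℕ) atTop :=
      (tendsto_natCast_atTop_atTop.comp hlam).mono_left Nat.hyperfilter_le_atTop
    have hfl : Tendsto (fun n => (⌊r * lam n⌋₊ : ℝ) / lam n) (hyperfilter ℕ) (𝓝 r) :=
      (tendsto_nat_floor_mul_div_atTop h0).comp hlam'
    have hd : Tendsto (scaledDist p m') (hyperfilter ℕ) (𝓝 r) := by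
      have := hfl.min (tendsto_scaledDist p q)
      rw [min_eq_left hr] at this
      refine this.congr fun n => ?_
      simp only [scaledDist, hm', hm1]
      rw [min_div_div_right (by positivity : (0 : ℝ) ≤ lam n)]
      push_cast; rfl
    refine ⟨SeparationQuotient.mk m', ?_, ?_⟩
    · rw [SeparationQuotient.dist_mk]
      exact tendsto_nhds_unique (tendsto_scaledDist _ _) hd
    · rw [SeparationQuotient.dist_mk, SeparationQuotient.dist_mk]
      refine tendsto_nhds_unique (tendsto_scaledDist _ _) ?_
      refine ((tendsto_scaledDist p q).sub hd).congr fun n => ?_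
      simp only [scaledDist, hm', hm1, hm2]
      rw [Nat.cast_sub (min_le_right _ _), sub_div]

/-- Elements fixing two points at positive distance in the asymptotic tree eventually have
commuting images. -/
theorem eventually_commute_of_dist_eq_zero (hlam : Tendsto lam atTop atTop)
    {p q z w : boundedSeq (α := α) lam} (hpq : 0 < dist p q) (hzp : dist p (z * p) = 0)
    (hzq : dist q (z * q) = 0) (hwp : dist p (w * p) = 0) (hwq : dist q (w * q) = 0) :
    ∀ᶠ n in hyperfilter ℕ, (z * w : boundedSeq (α := α) lam).1 n = (w * z).1 n := by
  have hlam' : Tendsto (fun n => (lam n : ℝ)) (hyperfilter ℕ) atTop :=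
    (tendsto_natCast_atTop_atTop.comp hlam).mono_left Nat.hyperfilter_le_atTop
  obtain ⟨D, hD⟩ : ∃ D, D = dist p q := ⟨_, rfl⟩
  rw [← hD] at hpq
  have small : ∀ a b : boundedSeq (α := α) lam, dist a b = 0 →
      ∀ᶠ n in hyperfilter ℕ, scaledDist a b n < D / 20 := fun a b hab => by
    have := tendsto_scaledDist a b
    rw [hab] at this
    exact this.eventually_lt_const (by positivity)
  have large : ∀ᶠ n in hyperfilter ℕ, D / 2 < scaledDist p q n := by
    refine (tendsto_scaledDist p q).eventually_const_lt ?_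
    linarith
  filter_upwards [small _ _ hzp, small _ _ hzq, small _ _ hwp, small _ _ hwq, large,
    hlam'.eventually_gt_atTop (100 / D)] with n h1 h2 h3 h4 h5 h6
  have hpos : (0 : ℝ) < lam n := lt_trans (by positivity) h6
  rw [div_lt_iff₀ hpq] at h6
  simp only [scaledDist, div_lt_iff₀ hpos, lt_div_iff₀ hpos, Subgroup.coe_mul, Pi.mul_apply]
    at h1 h2 h3 h4 h5 ⊢
  obtain ⟨ε, hε⟩ : ∃ ε : ℕ, ε = ⌊D / 20 * lam n⌋₊ := ⟨_, rfl⟩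
  have hle : (ε : ℝ) ≤ D / 20 * lam n := by
    rw [hε]; exact Nat.floor_le (by positivity)
  refine FreeGroup.commute_of_norm_le (p := p.1 n) (q := q.1 n) (ε := ε) ?_ ?_ ?_ ?_ ?_
  · rw [hε]; exact Nat.le_floor h1.le
  · rw [hε]; exact Nat.le_floor h2.le
  · rw [hε]; exact Nat.le_floor h3.le
  · rw [hε]; exact Nat.le_floor h4.le
  · have : (8 * ε + 8 : ℝ) < (((p : ℕ → FreeGroup α) n)⁻¹ * (q : ℕ → FreeGroup α) n).norm := by
      linarith
    exact_mod_cast this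

end Ultralimit

/-- A sequence of homomorphisms to a free group that is eventually injective on each nontrivial
element has a limiting isometric action on a metric tree whose arc stabilizers are abelian. -/
theorem exists_limitTree.{u, v} {α : Type u} [DecidableEq α] {H : Type v} [Group H]
    (f : ℕ → H →* FreeGroup α) {lam : ℕ → ℕ} (hlam : Tendsto lam atTop atTop)
    (hbd : ∀ h, ∃ C : ℕ, ∀ n, (f n h).norm ≤ C * lam n)
    (hinj : ∀ h, h ≠ 1 → ∀ᶠ n in atTop, f n h ≠ 1) :
    ∃ (T : Type u) (_ : MetricSpace T) (_ : MulAction H T), IsMetricTree T ∧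
      (∀ (g : H) (p q : T), dist (g • p) (g • q) = dist p q) ∧
      (∀ (p q : T) (g h : H), p ≠ q → g • p = p → g • q = q → h • p = p → h • q = q →
        g * h = h * g) ∧
      ∃ o : T, ∀ h : H, Tendsto (fun n => ((f n h).norm : ℝ) / lam n) (hyperfilter ℕ)
        (nhds (dist o (h • o))) := by
  let ρ : H →* boundedSeq (α := α) lam :=
    { toFun := fun h => ⟨fun n => f n h, hbd h⟩
      map_one' := by ext n; simp
      map_mul' := fun a b => by ext n; simp }
  let _ : MulAction H (boundedSeq (α := α) lam) := MulAction.compHom _ ρ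
  have hsmul : ∀ (h : H) (p : boundedSeq (α := α) lam), h • p = ρ h * p := fun _ _ => rfl
  have : IsIsometricSMul H (boundedSeq (α := α) lam) :=
    ⟨fun h => Isometry.of_dist_eq fun p q => boundedSeq_dist_mul (ρ h) p q⟩
  refine ⟨SeparationQuotient (boundedSeq (α := α) lam), inferInstance, inferInstance,
    isMetricTree_boundedSeq hlam, ?_, ?_, SeparationQuotient.mk 1, ?_⟩
  · intro g p q
    obtain ⟨p, rfl⟩ := SeparationQuotient.surjective_mk p
    obtain ⟨q, rfl⟩ := SeparationQuotient.surjective_mk q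
    simp only [← SeparationQuotient.mk_smul, SeparationQuotient.dist_mk, hsmul]
    exact boundedSeq_dist_mul _ _ _
  · intro p q g h hpq h1 h2 h3 h4
    obtain ⟨p, rfl⟩ := SeparationQuotient.surjective_mk p
    obtain ⟨q, rfl⟩ := SeparationQuotient.surjective_mk q
    have fixed : ∀ (g : H) (p : boundedSeq (α := α) lam),
        g • SeparationQuotient.mk p = SeparationQuotient.mk p → dist p (ρ g * p) = 0 := by
      intro g p hg
      rw [← hsmul, ← SeparationQuotient.dist_mk, SeparationQuotient.mk_smul, hg, dist_self]
    have hpos : 0 < dist p q := by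
      rw [← SeparationQuotient.dist_mk]
      exact dist_pos.2 hpq
    have hcomm := eventually_commute_of_dist_eq_zero hlam hpos (fixed g p h1) (fixed g q h2)
      (fixed h p h3) (fixed h q h4)
    by_contra hne
    have hev : ∀ᶠ n in hyperfilter ℕ, f n (g * h * (h * g)⁻¹) ≠ 1 :=
      (hinj _ (by rwa [Ne, mul_inv_eq_one])).filter_mono Nat.hyperfilter_le_atTop
    obtain ⟨n, hn1, hn2⟩ := (hcomm.and hev).exists
    apply hn2
    rw [map_mul, map_inv, mul_inv_eq_one, map_mul, map_mul]
    exact hn1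
  · intro h
    rw [← SeparationQuotient.mk_smul, SeparationQuotient.dist_mk, hsmul]
    refine (tendsto_scaledDist _ _).congr fun n => ?_
    simp [scaledDist, ρ]

/-- A sequence of homomorphisms from a free group of rank `r` which is unbounded on one element
and eventually injective on each nontrivial element: finitely many elements with bounded images
lie in a proper subgroup generated by at most `r` elements. -/
theorem FreeGroupBasis.exists_proper_subgroup {α ι H : Type*} [DecidableEq α] [Fintype ι]
    [Group H] (b : FreeGroupBasis ι H) (f : ℕ → H →* FreeGroup α)
    (hinj : ∀ h, h ≠ 1 → ∀ᶠ n in atTop, f n h ≠ 1) (k : H) (hk : ∀ n, n ≤ (f n k).norm)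
    (B : Finset H) (hB : ∀ g ∈ B, ∃ C : ℕ, ∀ n, (f n g).norm ≤ C) :
    ∃ s : Finset H, s.card ≤ Fintype.card ι ∧ Subgroup.closure (s : Set H) ≠ ⊤ ∧
      (B : Set H) ⊆ Subgroup.closure (s : Set H) := by
  obtain ⟨lam, hlam⟩ : ∃ lam : ℕ → ℕ, ∀ n, lam n = 1 + ∑ i, (f n (b i)).norm :=
    ⟨_, fun _ => rfl⟩
  have hbd : ∀ h, ∃ C : ℕ, ∀ n, (f n h).norm ≤ C * lam n := by
    intro h
    have hmem : h ∈ Subgroup.closure (Set.range b) := by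
      rw [b.closure_range_eq_top]; trivial
    induction hmem using Subgroup.closure_induction with
    | mem x hx =>
      obtain ⟨i, rfl⟩ := hx
      refine ⟨1, fun n => ?_⟩
      have := Finset.single_le_sum (f := fun i => (f n (b i)).norm) (fun _ _ => Nat.zero_le _)
        (Finset.mem_univ i)
      rw [hlam]
      omega
    | one => exact ⟨0, fun n => by simp⟩
    | mul x y _ _ hx hy =>
      obtain ⟨C, hC⟩ := hx
      obtain ⟨D, hD⟩ := hy
      refine ⟨C + D, fun n => ?_⟩
      rw [map_mul, add_mul]
      exact (FreeGroup.norm_mul_le _ _).trans (add_le_add (hC n) (hD n))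
    | inv x _ hx =>
      obtain ⟨C, hC⟩ := hx
      exact ⟨C, fun n => by simpa using hC n⟩
  have hlamtop : Tendsto lam atTop atTop := by
    obtain ⟨C, hC⟩ := hbd k
    refine tendsto_atTop.2 fun m => ?_
    filter_upwards [eventually_gt_atTop (C * m)] with n hn
    by_contra! hlt
    have h1 := (hk n).trans (hC n)
    have h2 : C * lam n ≤ C * m := Nat.mul_le_mul_left _ hlt.le
    omega
  obtain ⟨T, _, _, hT, hiso, hab, o, ho⟩ := exists_limitTree f hlamtop hbd hinj
  have hlam' : Tendsto (fun n => (lam n : ℝ)) (hyperfilter ℕ) atTop :=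
    (tendsto_natCast_atTop_atTop.comp hlamtop).mono_left Nat.hyperfilter_le_atTop
  have hfix : ∀ g ∈ B, g • o = o := by
    intro g hg
    obtain ⟨C, hC⟩ := hB g hg
    have hz : Tendsto (fun n => ((f n g).norm : ℝ) / lam n) (hyperfilter ℕ) (nhds 0) := by
      refine squeeze_zero (fun n => by positivity) (fun n => ?_)
        ((tendsto_const_nhds (x := (C : ℝ))).div_atTop hlam')
      gcongr
      exact_mod_cast hC n
    exact (dist_eq_zero.1 (tendsto_nhds_unique (ho g) hz)).symm
  obtain ⟨s, hcard, hs, hBs⟩ := MetricTree.exists_stabilizer_generators b hT hiso hab o B hfix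
  refine ⟨s, hcard, fun htop => ?_, hBs⟩
  have hstab : Subgroup.closure (s : Set H) ≤ MulAction.stabilizer H o :=
    (Subgroup.closure_le _).2 fun g hg => hs g hg
  rw [htop] at hstab
  have h0 : ∀ i, Tendsto (fun n => ((f n (b i)).norm : ℝ) / lam n) (hyperfilter ℕ) (nhds 0) := by
    intro i
    have h1 := ho (b i)
    rw [show b i • o = o from hstab (Subgroup.mem_top (b i)), dist_self] at h1
    exact h1
  have hsum : Tendsto (fun n => ∑ i, ((f n (b i)).norm : ℝ) / lam n) (hyperfilter ℕ)
      (nhds 0) := by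
    simpa using tendsto_finsetSum Finset.univ fun i _ => h0 i
  have hone : Tendsto (fun n => 1 / (lam n : ℝ) + ∑ i, ((f n (b i)).norm : ℝ) / lam n)
      (hyperfilter ℕ) (nhds 0) := by
    simpa using (tendsto_const_nhds (x := (1 : ℝ)).div_atTop hlam').add hsum
  have hconst : Tendsto (fun n => 1 / (lam n : ℝ) + ∑ i, ((f n (b i)).norm : ℝ) / lam n)
      (hyperfilter ℕ) (nhds 1) := by
    refine tendsto_const_nhds.congr fun n => ?_
    have hpos : (lam n : ℝ) ≠ 0 := by
      rw [hlam]; positivity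
    rw [← Finset.sum_div, ← add_div, eq_comm, div_eq_one_iff_eq hpos, hlam]
    push_cast; rfl
  exact zero_ne_one (tendsto_nhds_unique hone hconst)

section ExistentialClosure

open FirstOrder.Language

variable {F : Type*} [Group F] {γ : Type*} {n : ℕ}

theorem exists_finset_realize_term (t : grpLang.Term γ) (v : γ → F) :
    ∃ A₀ : Finset γ, ∀ (f : F →* F) (v' : γ → F), (∀ a ∈ A₀, v' a = f (v a)) →
      t.realize v' = f (t.realize v) := by
  classical
  induction t with
  | var a => exact ⟨{a}, fun f v' h => h a (Finset.mem_singleton_self a)⟩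
  | func g ts ih =>
    choose A₀ hA₀ using ih
    refine ⟨Finset.univ.biUnion A₀, fun f v' h => ?_⟩
    have h' : ∀ i, (ts i).realize v' = f ((ts i).realize v) := fun i =>
      hA₀ i f v' fun a ha => h a (Finset.mem_biUnion.2 ⟨i, Finset.mem_univ i, ha⟩)
    simp only [Term.realize_func, h']
    cases g with
    | one => exact (map_one f).symm
    | inv => exact (map_inv f _).symm
    | mul => exact (map_mul f _ _).symm

/-- The truth of a quantifier-free formula is preserved by every endomorphism which does not kill
certain finitely many nontrivial elements. -/
theorem exists_finset_realize_isQF {ψ : grpLang.BoundedFormula γ n} (hψ : ψ.IsQF) (v : γ → F)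
    (xs : Fin n → F) :
    ∃ (A₀ : Finset γ) (S : Finset F), (∀ s ∈ S, s ≠ 1) ∧ ∀ (f : F →* F) (v' : γ → F),
      (∀ a ∈ A₀, v' a = f (v a)) → (∀ s ∈ S, f s ≠ 1) →
      (ψ.Realize v' (f ∘ xs) ↔ ψ.Realize v xs) := by
  classical
  induction hψ with
  | falsum => exact ⟨∅, ∅, by simp, fun _ _ _ _ => Iff.rfl⟩
  | of_isAtomic h =>
    cases h with
    | rel R => exact R.elim
    | equal t₁ t₂ =>
      have term : ∀ t : grpLang.Term (γ ⊕ Fin _), ∃ A₀ : Finset γ, ∀ (f : F →* F) (v' : γ → F),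
          (∀ a ∈ A₀, v' a = f (v a)) →
          t.realize (Sum.elim v' (f ∘ xs)) = f (t.realize (Sum.elim v xs)) := by
        intro t
        obtain ⟨A, hA⟩ := exists_finset_realize_term t (Sum.elim v xs)
        refine ⟨A.preimage Sum.inl Sum.inl_injective.injOn, fun f v' h => hA f _ ?_⟩
        rintro (a | i) ha
        · exact h a (by simpa using ha)
        · rfl
      obtain ⟨A₁, h₁⟩ := term t₁
      obtain ⟨A₂, h₂⟩ := term t₂
      by_cases heq : t₁.realize (Sum.elim v xs) = t₂.realize (Sum.elim v xs)
      · refine ⟨A₁ ∪ A₂, ∅, by simp, fun f v' hv _ => ?_⟩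
        rw [BoundedFormula.realize_bdEqual, BoundedFormula.realize_bdEqual,
          h₁ f v' fun a ha => hv a (Finset.mem_union_left _ ha),
          h₂ f v' fun a ha => hv a (Finset.mem_union_right _ ha)]
        simp [heq]
      · refine ⟨A₁ ∪ A₂, {t₁.realize (Sum.elim v xs) * (t₂.realize (Sum.elim v xs))⁻¹}, ?_,
          fun f v' hv hS => ?_⟩
        · simpa [mul_inv_eq_one] using heq
        · rw [BoundedFormula.realize_bdEqual, BoundedFormula.realize_bdEqual,
            h₁ f v' fun a ha => hv a (Finset.mem_union_left _ ha),
            h₂ f v' fun a ha => hv a (Finset.mem_union_right _ ha)]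
          have := hS _ (Finset.mem_singleton_self _)
          rw [map_mul, map_inv, Ne, mul_inv_eq_one] at this
          simp [heq, this]
  | imp _ _ ih₁ ih₂ =>
    obtain ⟨A₁, S₁, hS₁, h₁⟩ := ih₁
    obtain ⟨A₂, S₂, hS₂, h₂⟩ := ih₂
    refine ⟨A₁ ∪ A₂, S₁ ∪ S₂, ?_, fun f v' hv hS => ?_⟩
    · intro s hs
      rcases Finset.mem_union.1 hs with h | h
      exacts [hS₁ s h, hS₂ s h]
    · rw [BoundedFormula.realize_imp, BoundedFormula.realize_imp,
        h₁ f v' (fun a ha => hv a (Finset.mem_union_left _ ha))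
          fun s hs => hS s (Finset.mem_union_left _ hs),
        h₂ f v' (fun a ha => hv a (Finset.mem_union_right _ ha))
          fun s hs => hS s (Finset.mem_union_right _ hs)]

/-- The images of `b` under the endomorphisms that fix `A₀` pointwise and kill no element
of `S`. -/
def homOrbit (A₀ S : Set F) (b : F) : Set F :=
  {c | ∃ f : F →* F, (∀ a ∈ A₀, f a = a) ∧ (∀ s ∈ S, f s ≠ 1) ∧ f b = c}

theorem exists_finite_homOrbit_of_mem_aclE {A : Set F} {b : F} (hb : b ∈ aclE A) :
    ∃ A₀ S : Finset F, (A₀ : Set F) ⊆ A ∧ (∀ s ∈ S, s ≠ 1) ∧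
      (homOrbit (A₀ : Set F) (S : Set F) b).Finite := by
  classical
  obtain ⟨_, ⟨n, ψ, hψ, rfl⟩, hfin, hreal⟩ := hb
  obtain ⟨xs, hxs⟩ := BoundedFormula.realize_exs.1 hreal
  obtain ⟨A₀, S, hS, h⟩ := exists_finset_realize_isQF hψ _ xs
  refine ⟨(A₀.preimage Sum.inl Sum.inl_injective.injOn).map (Function.Embedding.subtype _), S,
    ?_, hS, hfin.subset ?_⟩
  · intro x hx
    obtain ⟨y, -, rfl⟩ := Finset.mem_map.1 hx
    exact y.2
  · rintro _ ⟨f, hfA, hfS, rfl⟩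
    refine BoundedFormula.realize_exs.2 ⟨f ∘ xs, (h f _ ?_ hfS).2 hxs⟩
    rintro (a | i) ha
    · refine (hfA _ ?_).symm
      exact Finset.mem_map.2 ⟨a, by simpa using ha, rfl⟩
    · rfl

theorem exists_term_realize_eq {x : Fin n → F} (hx : Subgroup.closure (Set.range x) = ⊤)
    (w : F) : ∃ t : grpLang.Term (Fin n), ∀ f : F →* F, t.realize (f ∘ x) = f w := by
  have hmem : w ∈ Subgroup.closure (Set.range x) := by
    rw [hx]; trivial
  induction hmem using Subgroup.closure_induction with
  | mem w hw =>
    obtain ⟨i, rfl⟩ := hw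
    exact ⟨.var i, fun f => rfl⟩
  | one => exact ⟨.func GrpFunc.one ![], fun f => (map_one f).symm⟩
  | mul u v _ _ hu hv =>
    obtain ⟨s, hs⟩ := hu
    obtain ⟨t, ht⟩ := hv
    refine ⟨.func GrpFunc.mul ![s, t], fun f => ?_⟩
    rw [map_mul, ← hs, ← ht]
    rfl
  | inv u _ hu =>
    obtain ⟨s, hs⟩ := hu
    refine ⟨.func GrpFunc.inv ![s], fun f => ?_⟩
    rw [map_inv, ← hs]
    rfl

theorem exists_isQF_forall {β : Type*} (s : Finset β) (φ : β → grpLang.BoundedFormula γ n)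
    (hφ : ∀ i, (φ i).IsQF) :
    ∃ ψ : grpLang.BoundedFormula γ n, ψ.IsQF ∧ ∀ (v : γ → F) (xs : Fin n → F),
      ψ.Realize v xs ↔ ∀ i ∈ s, (φ i).Realize v xs := by
  classical
  induction s using Finset.induction_on with
  | empty => exact ⟨⊤, BoundedFormula.IsQF.top, fun v xs => by simp⟩
  | insert i s _ ih =>
    obtain ⟨ψ, hψ, h⟩ := ih
    refine ⟨φ i ⊓ ψ, (hφ i).inf hψ, fun v xs => ?_⟩
    rw [BoundedFormula.realize_inf, h, Finset.forall_mem_insert]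

theorem mem_aclE_of_finite_homOrbit (b : FreeGroupBasis (Fin n) F) {A : Set F} (A₀ : Finset A)
    (S : Finset F) {k : F} (hS : ∀ s ∈ S, s ≠ 1)
    (hfin : (homOrbit (Subtype.val '' (A₀ : Set A)) (S : Set F) k).Finite) : k ∈ aclE A := by
  classical
  choose t ht using exists_term_realize_eq b.closure_range_eq_top
  obtain ⟨T, hT⟩ : ∃ T : F → grpLang.Term ((A ⊕ Fin 1) ⊕ Fin n),
      ∀ w (f : F →* F) v, (T w).realize (Sum.elim v (f ∘ b)) = f w :=
    ⟨fun w => (t w).relabel Sum.inr, fun w f v => by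
      rw [Term.realize_relabel, Sum.elim_comp_inr, ht]⟩
  have hQF : ∀ t₁ t₂ : grpLang.Term ((A ⊕ Fin 1) ⊕ Fin n), (t₁.bdEqual t₂).IsQF :=
    fun t₁ t₂ => (BoundedFormula.IsAtomic.equal t₁ t₂).isQF
  obtain ⟨φ₁, hφ₁, h₁⟩ := exists_isQF_forall (F := F) A₀
    (fun a : A => (Term.var (Sum.inl (Sum.inl a))).bdEqual (T a)) fun _ => hQF _ _
  obtain ⟨φ₂, hφ₂, h₂⟩ := exists_isQF_forall (F := F) S
    (fun s : F => ((T s).bdEqual (T 1)).not) fun _ => (hQF _ _).not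
  obtain ⟨φ₀, hφ₀⟩ : ∃ φ₀, φ₀ =
    (Term.var (Sum.inl (Sum.inr 0)) : grpLang.Term ((A ⊕ Fin 1) ⊕ Fin n)).bdEqual (T k) :=
    ⟨_, rfl⟩
  have hreal : ∀ c : F, (φ₀ ⊓ φ₁ ⊓ φ₂).exs.Realize (Sum.elim Subtype.val fun _ => c) ↔
      c ∈ homOrbit (Subtype.val '' (A₀ : Set A)) (S : Set F) k := by
    intro c
    rw [BoundedFormula.realize_exs]
    have key : ∀ f : F →* F,
        (φ₀ ⊓ φ₁ ⊓ φ₂).Realize (Sum.elim Subtype.val fun _ => c) (f ∘ b) ↔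
        (∀ a ∈ Subtype.val '' (A₀ : Set A), f a = a) ∧ (∀ s ∈ (S : Set F), f s ≠ 1) ∧
          f k = c := by
      intro f
      rw [BoundedFormula.realize_inf, BoundedFormula.realize_inf, h₁, h₂, hφ₀]
      simp only [BoundedFormula.realize_not, BoundedFormula.realize_bdEqual, hT,
        Term.realize_var, Sum.elim_inl, Sum.elim_inr, map_one, Set.forall_mem_image,
        Finset.mem_coe]
      constructor
      · rintro ⟨⟨h, h'⟩, h''⟩
        exact ⟨fun a ha => (h' a ha).symm, h'', h.symm⟩
      · rintro ⟨h', h'', h⟩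
        exact ⟨⟨h.symm, fun a ha => (h' ha).symm⟩, h''⟩
    constructor
    · rintro ⟨xs, hxs⟩
      refine ⟨b.lift xs, (key _).1 ?_⟩
      convert hxs
      funext i
      simp
    · rintro ⟨f, hf⟩
      exact ⟨f ∘ b, (key f).2 hf⟩
  refine ⟨(φ₀ ⊓ φ₁ ⊓ φ₂).exs, ⟨n, _, ((hφ₀ ▸ hQF _ _).inf hφ₁).inf hφ₂, rfl⟩, ?_, ?_⟩
  · simp only [hreal]
    exact hfin
  · rw [hreal]
    exact ⟨MonoidHom.id F, fun _ _ => rfl, fun s hs => hS s hs, rfl⟩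

end ExistentialClosure

theorem FreeGroup.finite_norm_le {α : Type*} [DecidableEq α] [Finite α] (m : ℕ) :
    {w : FreeGroup α | w.norm ≤ m}.Finite :=
  (List.finite_length_le (α × Bool) m).preimage toWord_injective.injOn

/-- An element outside the existential algebraic closure of `A` is moved arbitrarily far by
endomorphisms which are eventually injective and have bounded orbits on the closure of `A`. -/
theorem exists_hom_sequence {F : Type*} [Group F] {n : ℕ} (e : F ≃* FreeGroup (Fin n))
    {A : Set F} {k : F} (hk : k ∉ aclE A) :
    ∃ f : ℕ → F →* F, (∀ h, h ≠ 1 → ∀ᶠ m in atTop, f m h ≠ 1) ∧ (∀ m, m ≤ (e (f m k)).norm) ∧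
      ∀ g ∈ Subgroup.closure (aclE A), ∃ C : ℕ, ∀ m, (e (f m g)).norm ≤ C := by
  classical
  have : Countable (FreeGroup (Fin n)) := FreeGroup.toWord_injective.countable
  have : Countable F := e.injective.countable
  obtain ⟨c, hc⟩ := exists_injective_nat F
  have hfinlt : ∀ m, {x : F | c x < m}.Finite := fun m =>
    (Set.finite_lt_nat m).preimage hc.injOn
  have key : ∀ m : ℕ, ∃ f : F →* F, (∀ a ∈ A, c a < m → f a = a) ∧
      (∀ s, s ≠ 1 → c s < m → f s ≠ 1) ∧ m ≤ (e (f k)).norm := by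
    intro m
    have hA : {a : A | c a < m}.Finite := (hfinlt m).preimage Subtype.val_injective.injOn
    have hS : {s : F | s ≠ 1 ∧ c s < m}.Finite := (hfinlt m).subset fun s hs => hs.2
    have hinf : ¬ (homOrbit (Subtype.val '' (hA.toFinset : Set A)) (hS.toFinset : Set F) k).Finite :=
      fun hfin => hk (mem_aclE_of_finite_homOrbit (FreeGroupBasis.ofRepr e) hA.toFinset
        hS.toFinset (fun s hs => (hS.mem_toFinset.1 hs).1) hfin)
    have hball : {x : F | (e x).norm ≤ m}.Finite :=
      (FreeGroup.finite_norm_le m).preimage e.injective.injOn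
    obtain ⟨x, ⟨f, hfA, hfS, rfl⟩, hx⟩ := (Set.Infinite.sdiff hinf hball).nonempty
    refine ⟨f, fun a ha hca => hfA a ⟨⟨a, ha⟩, ?_, rfl⟩, fun s hs hcs => hfS s ?_, ?_⟩
    · simpa using hca
    · simpa using And.intro hs hcs
    · exact (not_le.1 hx).le
  choose f hfA hfS hfk using key
  refine ⟨f, fun h hh => ?_, hfk, fun g hg => ?_⟩
  · filter_upwards [eventually_gt_atTop (c h)] with m hm
    exact hfS m h hh hm
  induction hg using Subgroup.closure_induction with
  | mem g hg =>
    obtain ⟨A₀, S, hA₀, hS, hfin⟩ := exists_finite_homOrbit_of_mem_aclE hg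
    have hev : ∀ᶠ m in atTop, f m g ∈ homOrbit (A₀ : Set F) (S : Set F) g := by
      have h1 : ∀ᶠ m in atTop, ∀ a ∈ A₀, f m a = a := by
        rw [eventually_all_finset]
        intro a ha
        filter_upwards [eventually_gt_atTop (c a)] with m hm
        exact hfA m a (hA₀ ha) hm
      have h2 : ∀ᶠ m in atTop, ∀ s ∈ S, f m s ≠ 1 := by
        rw [eventually_all_finset]
        intro s hs
        filter_upwards [eventually_gt_atTop (c s)] with m hm
        exact hfS m s (hS s hs) hm
      filter_upwards [h1, h2] with m h1 h2
      exact ⟨f m, h1, h2, rfl⟩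
    obtain ⟨N, hN⟩ := eventually_atTop.1 hev
    have hfin' : (homOrbit (A₀ : Set F) (S : Set F) g ∪
        (fun m => f m g) '' Set.Iio N).Finite := hfin.union ((Set.finite_Iio N).image _)
    obtain ⟨C, hC⟩ := (hfin'.image fun x => (e x).norm).bddAbove
    refine ⟨C, fun m => hC ⟨f m g, ?_, rfl⟩⟩
    rcases lt_or_ge m N with h | h
    · exact Or.inr ⟨m, h, rfl⟩
    · exact Or.inl (hN m h)
  | one => exact ⟨0, fun m => by simp⟩
  | mul x y _ _ hx hy =>
    obtain ⟨C, hC⟩ := hx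
    obtain ⟨D, hD⟩ := hy
    refine ⟨C + D, fun m => ?_⟩
    rw [map_mul, map_mul]
    exact (FreeGroup.norm_mul_le _ _).trans (add_le_add (hC m) (hD m))
  | inv x _ hx =>
    obtain ⟨C, hC⟩ := hx
    exact ⟨C, fun m => by simpa using hC m⟩

/-! ### Subgroups with a bounded number of generators -/

section GeneratedBy

variable {G : Type*} [Group G] {r : ℕ}

/-- A subgroup generated by at most `r` elements. -/
def GeneratedBy (r : ℕ) (H : Subgroup G) : Prop :=
  ∃ s : Finset G, s.card ≤ r ∧ Subgroup.closure (s : Set G) = H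

theorem GeneratedBy.exists_finset {H : Subgroup G} (h : GeneratedBy r H) :
    ∃ t : Finset H, t.card ≤ r ∧ Subgroup.closure (t : Set H) = ⊤ := by
  classical
  obtain ⟨s, hs, rfl⟩ := h
  refine ⟨s.preimage Subtype.val Subtype.val_injective.injOn, ?_, ?_⟩
  · exact (Finset.card_le_card_of_injOn Subtype.val (fun x hx => by simpa using hx)
      Subtype.val_injective.injOn).trans hs
  · rw [Finset.coe_preimage]
    exact Subgroup.closure_closure_coe_preimage

theorem GeneratedBy.range {G' : Type*} [Group G'] {H : Subgroup G} (h : GeneratedBy r H)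
    (φ : H →* G') : GeneratedBy r φ.range := by
  classical
  obtain ⟨t, ht, htop⟩ := h.exists_finset
  refine ⟨t.image φ, Finset.card_image_le.trans ht, ?_⟩
  rw [Finset.coe_image, ← MonoidHom.map_closure, htop, MonoidHom.range_eq_map]

/-- Elements on which homomorphisms to `ℤ/2` take arbitrary values are at most as many as the
generators. -/
theorem GeneratedBy.finite_and_card_le {H : Subgroup G} (h : GeneratedBy r H) {κ : Type*}
    (e : κ → H) (hext : ∀ g : κ → Multiplicative (ZMod 2),
      ∃ φ : H →* Multiplicative (ZMod 2), ∀ i, φ (e i) = g i) :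
    Finite κ ∧ Nat.card κ ≤ r := by
  classical
  obtain ⟨t, ht, htop⟩ := h.exists_finset
  choose φ hφ using hext
  have hinj : Function.Injective fun (g : κ → Multiplicative (ZMod 2)) (x : t) => φ g x := by
    intro g g' hgg
    have : φ g = φ g' := MonoidHom.eq_of_eqOn_dense htop fun x hx =>
      congrFun hgg (⟨x, hx⟩ : t)
    funext i
    rw [← hφ g i, ← hφ g' i, this]
  have : Finite (Multiplicative (ZMod 2)) := inferInstanceAs (Finite (ZMod 2))
  have : Nontrivial (Multiplicative (ZMod 2)) := inferInstanceAs (Nontrivial (ZMod 2))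
  have hfin : Finite (κ → Multiplicative (ZMod 2)) := Finite.of_injective _ hinj
  obtain ⟨a, ha⟩ := exists_ne (1 : Multiplicative (ZMod 2))
  have hκ : Finite κ := Finite.of_injective
    (fun i => (Pi.mulSingle i a : κ → Multiplicative (ZMod 2))) fun i j hij => by
      by_contra hne
      apply ha
      have := congrFun hij i
      simpa [Pi.mulSingle_eq_of_ne hne] using this
  refine ⟨hκ, ?_⟩
  have hcard := Nat.card_le_card_of_injective _ hinj
  have h2 : Nat.card (Multiplicative (ZMod 2)) = 2 := Nat.card_zmod 2
  rw [Nat.card_fun, Nat.card_fun, h2] at hcard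
  have := (Nat.pow_le_pow_iff_right (by norm_num)).1 hcard
  rw [Nat.card_eq_fintype_card (α := t), Fintype.card_coe] at this
  exact this.trans ht

end GeneratedBy

/-- A connected finite set of cosets determines a retraction of a subgroup of a free group onto
the subgroup generated by the elements it carries. -/
theorem FreeGroupBasis.generatedBy_closure {ι F : Type*} [Group F] [Fintype ι]
    (b : FreeGroupBasis ι F) {V : Finset F} (h1 : 1 ∈ V)
    (hV : GraphLinked (fun e : F × ι => e.1) (fun e => b e.2 * e.1) (cayleyEdges b V) V 1)
    {r : ℕ} {H : Subgroup F} (hH : GeneratedBy r H) :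
    GeneratedBy r (Subgroup.closure {h | h ∈ H ∧ ∃ u ∈ V, ∃ v ∈ V, h = v⁻¹ * u}) := by
  classical
  obtain ⟨E, hE⟩ : ∃ E, E = Subgroup.closure {h | h ∈ H ∧ ∃ u ∈ V, ∃ v ∈ V, h = v⁻¹ * u} :=
    ⟨_, rfl⟩
  rw [← hE]
  have hmem : ∀ u ∈ V, ∀ v ∈ V, (v : F ⧸ H) = u → v⁻¹ * u ∈ E := fun u hu v hv huv => by
    rw [hE]
    exact Subgroup.subset_closure ⟨QuotientGroup.eq.1 huv, u, hu, v, hv, rfl⟩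
  have hτ : ∀ y : F ⧸ H, ∃ t : F, (y = ((1 : F) : F ⧸ H) → t = 1) ∧
      ∀ u ∈ V, (u : F ⧸ H) = y → t ∈ V ∧ (t : F ⧸ H) = y := by
    intro y
    by_cases hy : y = ((1 : F) : F ⧸ H)
    · exact ⟨1, fun _ => rfl, fun _ _ _ => ⟨h1, hy.symm⟩⟩
    · by_cases hu : ∃ u ∈ V, (u : F ⧸ H) = y
      · obtain ⟨u, hu, huy⟩ := hu
        exact ⟨u, fun h => absurd h hy, fun _ _ _ => ⟨hu, huy⟩⟩
      · exact ⟨1, fun _ => rfl, fun u hu' huy => absurd ⟨u, hu', huy⟩ hu⟩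
  choose τ hτ1 hτV using hτ
  have hμ : ∀ (y : F ⧸ H) (i : ι), ∃ m : E, ∀ u ∈ V, (u : F ⧸ H) = y → b i * u ∈ V →
      (m : F) = (τ (b i • y))⁻¹ * b i * τ y := by
    intro y i
    by_cases hu : ∃ u ∈ V, (u : F ⧸ H) = y ∧ b i * u ∈ V
    · obtain ⟨u, hu, huy, hbu⟩ := hu
      obtain ⟨t1, t2⟩ := hτV y u hu huy
      have hby : ((b i * u : F) : F ⧸ H) = b i • y := by rw [← huy]; rfl
      obtain ⟨t3, t4⟩ := hτV (b i • y) (b i * u) hbu hby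
      refine ⟨⟨(τ (b i • y))⁻¹ * b i * τ y, ?_⟩, fun _ _ _ _ => rfl⟩
      have : (τ (b i • y))⁻¹ * b i * τ y = ((τ (b i • y))⁻¹ * (b i * u)) * (u⁻¹ * τ y) := by
        group
      rw [this]
      exact E.mul_mem (hmem _ hbu _ t3 (t4.trans hby.symm)) (hmem _ t1 _ hu (huy.trans t2.symm))
    · exact ⟨1, fun u hu' huy hbu => absurd ⟨u, hu', huy, hbu⟩ hu⟩
  choose μ hμ using hμ
  obtain ⟨c, hc, hcb⟩ := b.exists_cocycle μ
  obtain ⟨o, ho⟩ : ∃ o : F ⧸ H, o = ((1 : F) : F ⧸ H) := ⟨_, rfl⟩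
  have hsmul : ∀ g : F, g • o = (g : F ⧸ H) := fun g => by
    rw [ho]
    exact congrArg _ (mul_one g)
  have hcV : ∀ u ∈ V, (c u o : F) = (τ u)⁻¹ * u := by
    refine hV _ ?_ ?_
    · have : c 1 o = 1 := by simpa using hc 1 1 o
      rw [this, hτ1 _ rfl]; simp
    · rintro ⟨u, i⟩ he
      obtain ⟨hu, hbu⟩ := mem_cayleyEdges.1 he
      have hby : ((b i * u : F) : F ⧸ H) = b i • (u : F ⧸ H) := rfl
      have key : (c (b i * u) o : F) = (τ (b i * u : F))⁻¹ * b i * τ u * c u o := by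
        rw [hc, hcb, hsmul, E.coe_mul, hμ _ _ u hu rfl hbu, hby]
      simp only at hu hbu ⊢
      rw [key, mul_assoc, mul_assoc, mul_right_inj, mul_right_inj]
      constructor
      · intro h; rw [h]; group
      · exact eq_inv_mul_of_mul_eq
  have hfix : ∀ h : H, (h : F) • o = o := fun h => by
    rw [hsmul, ho, eq_comm, QuotientGroup.eq]
    simp
  let ρ : H →* F := E.subtype.comp
    { toFun := fun h => c h o
      map_one' := by simpa using hc 1 1 o
      map_mul' := fun g h => by
        rw [Subgroup.coe_mul, hc, hfix] }
  have hρ : ∀ h : H, ρ h = c h o := fun _ => rfl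
  have hrange : ρ.range = E := by
    refine le_antisymm ?_ ?_
    · rintro _ ⟨h, rfl⟩
      exact (c h o).2
    · rw [hE, Subgroup.closure_le]
      rintro h ⟨hh, u, hu, v, hv, rfl⟩
      refine ⟨⟨v⁻¹ * u, hh⟩, ?_⟩
      have h2 := hc v (v⁻¹ * u) o
      rw [mul_inv_cancel_left, hfix ⟨_, hh⟩] at h2
      have h3 := congrArg (Subtype.val) h2
      rw [E.coe_mul, hcV u hu, hcV v hv, QuotientGroup.eq.2 hh, mul_assoc, mul_right_inj] at h3
      rw [hρ, ← mul_right_inj v, ← h3, mul_inv_cancel_left]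
  rw [← hrange]
  exact hH.range ρ

/-- If every `r`-generated subgroup not contained in `B` can be shrunk while keeping given finitely
many elements of `B`, then finite subsets of `B` lie in `r`-generated subgroups of `B`. -/
theorem FreeGroupBasis.exists_generatedBy_le {ι F : Type*} [Group F] [Fintype ι]
    (b : FreeGroupBasis ι F) {B K : Subgroup F} {r : ℕ} (hK : GeneratedBy r K) (hBK : B ≤ K)
    (hshrink : ∀ H : Subgroup F, GeneratedBy r H → ¬ H ≤ B → ∀ B₀ : Finset F,
      (B₀ : Set F) ⊆ B → (B₀ : Set F) ⊆ H → ∃ E < H, GeneratedBy r E ∧ (B₀ : Set F) ⊆ E)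
    (B₀ : Finset F) (hB₀ : (B₀ : Set F) ⊆ B) :
    ∃ H ≤ B, GeneratedBy r H ∧ (B₀ : Set F) ⊆ H := by
  classical
  obtain ⟨V, h1, hBV, hV⟩ := b.exists_connected_finset B₀
  obtain ⟨core, hcore⟩ : ∃ core : Subgroup F → Set F,
      ∀ H, core H = {h | h ∈ H ∧ ∃ u ∈ V, ∃ v ∈ V, h = v⁻¹ * u} := ⟨_, fun _ => rfl⟩
  have hcore_gen : ∀ H, GeneratedBy r H → GeneratedBy r (Subgroup.closure (core H)) :=
    fun H hH => by rw [hcore]; exact b.generatedBy_closure h1 hV hH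
  have hcore_le : ∀ H, Subgroup.closure (core H) ≤ H := fun H => by
    rw [hcore, Subgroup.closure_le]
    exact fun h hh => hh.1
  have hcore_sub : ∀ H : Subgroup F, (B₀ : Set F) ⊆ H →
      (B₀ : Set F) ⊆ Subgroup.closure (core H) := fun H hH x hx => by
    rw [hcore]
    exact Subgroup.subset_closure ⟨hH hx, x, hBV hx, 1, h1, by simp⟩
  have hcore_fin : (Set.range core).Finite := by
    refine (V ×ˢ V |>.image fun p => p.2⁻¹ * p.1).finite_toSet.finite_subsets.subset ?_
    rintro _ ⟨H, rfl⟩ h hh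
    rw [hcore] at hh
    obtain ⟨-, u, hu, v, hv, rfl⟩ := hh
    exact Finset.mem_image.2 ⟨(u, v), Finset.mem_product.2 ⟨hu, hv⟩, rfl⟩
  obtain ⟨𝓕, h𝓕⟩ : ∃ 𝓕 : Set (Subgroup F), 𝓕 = {H | H ∈ Subgroup.closure '' Set.range core ∧
    GeneratedBy r H ∧ (B₀ : Set F) ⊆ H} := ⟨_, rfl⟩
  have hcore_mem : ∀ H : Subgroup F, GeneratedBy r H → (B₀ : Set F) ⊆ H →
      Subgroup.closure (core H) ∈ 𝓕 := fun H hH hBH => by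
    rw [h𝓕]
    exact ⟨⟨_, ⟨H, rfl⟩, rfl⟩, hcore_gen H hH, hcore_sub H hBH⟩
  have hfin : 𝓕.Finite := by
    rw [h𝓕]
    exact (hcore_fin.image _).subset fun H hH => hH.1
  obtain ⟨H, hH⟩ := hfin.exists_minimal
    ⟨_, hcore_mem K hK (hB₀.trans (SetLike.coe_subset_coe.2 hBK))⟩
  obtain ⟨-, hgen, hsub⟩ : H ∈ {H | H ∈ Subgroup.closure '' Set.range core ∧
    GeneratedBy r H ∧ (B₀ : Set F) ⊆ H} := h𝓕 ▸ hH.prop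
  refine ⟨H, ?_, hgen, hsub⟩
  by_contra hHB
  obtain ⟨E, hEH, hE, hBE⟩ := hshrink H hgen hHB B₀ hB₀ hsub
  exact hEH.not_ge ((hH.le_of_le (hcore_mem E hE hBE) ((hcore_le E).trans hEH.le)).trans
    (hcore_le E))

theorem exists_lt_generatedBy_of_not_le_aclE {F : Type*} [Group F] {n : ℕ}
    (e : F ≃* FreeGroup (Fin n)) {A : Set F} {r : ℕ} {H : Subgroup F} (hH : GeneratedBy r H)
    (hHA : ¬ H ≤ Subgroup.closure (aclE A)) {B₀ : Finset F}
    (hB₀ : (B₀ : Set F) ⊆ Subgroup.closure (aclE A)) (hBH : (B₀ : Set F) ⊆ H) :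
    ∃ E < H, GeneratedBy r E ∧ (B₀ : Set F) ⊆ E := by
  classical
  have : IsFreeGroup F := (FreeGroupBasis.ofRepr e).isFreeGroup
  obtain ⟨k, hkH, hkB⟩ := SetLike.not_le_iff_exists.1 hHA
  obtain ⟨f, hinj, hk, hbd⟩ := exists_hom_sequence e fun h => hkB (Subgroup.subset_closure h)
  have b := IsFreeGroup.basis H
  obtain ⟨hfin, hcard⟩ := hH.finite_and_card_le b fun g => ⟨b.lift g, fun i => by simp⟩
  have := Fintype.ofFinite (IsFreeGroup.Generators H)
  rw [Nat.card_eq_fintype_card] at hcard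
  obtain ⟨s, hs, htop, hBs⟩ := b.exists_proper_subgroup
    (fun m => e.toMonoidHom.comp ((f m).comp H.subtype)) (fun h hh => by
      filter_upwards [hinj h (by simpa using hh)] with m hm
      simpa using hm) ⟨k, hkH⟩ hk
    (B₀.preimage Subtype.val Subtype.val_injective.injOn)
    fun g hg => hbd g (hB₀ (by simpa using hg))
  refine ⟨(Subgroup.closure (s : Set H)).map H.subtype, ?_, ⟨s.image H.subtype,
    (Finset.card_image_le.trans hs).trans hcard, ?_⟩, fun x hx => ?_⟩
  · refine lt_of_le_of_ne (Subgroup.map_subtype_le _) fun h => htop ?_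
    refine Subgroup.map_injective H.subtype_injective (h.trans ?_)
    rw [← MonoidHom.range_eq_map, Subgroup.range_subtype]
  · rw [Finset.coe_image, MonoidHom.map_closure]
  · exact ⟨⟨x, hBH hx⟩, hBs (by simpa using hx), rfl⟩

theorem srank_le_of_generatedBy {G : Type*} [Group G] {H : Subgroup G} {r : ℕ}
    (h : GeneratedBy r H) : srank H ≤ r := by
  obtain ⟨s, hs, hH⟩ := h
  refine (csInf_le' (Set.mem_ofPred_eq.mpr ⟨(s : Set G), hH, rfl⟩)).trans ?_
  rw [Finset.coe_sort_coe, Cardinal.mk_coe_finset]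
  exact_mod_cast hs

theorem exists_generatedBy_eq_srank {G : Type*} [Group G] {K : Subgroup G} (hK : K.FG) :
    ∃ r : ℕ, GeneratedBy r K ∧ srank K = r := by
  obtain ⟨S, hS, hcard⟩ : srank K ∈ {c : Cardinal | ∃ S : Set G, Subgroup.closure S = K ∧
    c = Cardinal.mk S} := csInf_mem ⟨_, K, Subgroup.closure_eq K, rfl⟩
  obtain ⟨s, hs⟩ := hK
  have hlt : Cardinal.mk S < Cardinal.aleph0 := by
    rw [← hcard]
    exact (srank_le_of_generatedBy ⟨s, le_rfl, hs⟩).trans_lt Cardinal.natCast_lt_aleph0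
  have hfin : S.Finite := Cardinal.lt_aleph0_iff_set_finite.1 hlt
  refine ⟨hfin.toFinset.card, ⟨hfin.toFinset, le_rfl, by simpa using hS⟩, ?_⟩
  rw [hcard, ← Cardinal.mk_coe_finset]
  simp

/-- A free group all of whose finite subsets lie in `r`-generated subgroups is `r`-generated. -/
theorem FreeGroupBasis.generatedBy_of_forall_finset {F ι : Type*} [Group F] {B : Subgroup F}
    (b : FreeGroupBasis ι B) {r : ℕ} (h : ∀ B₀ : Finset F, (B₀ : Set F) ⊆ B →
      ∃ H ≤ B, GeneratedBy r H ∧ (B₀ : Set F) ⊆ H) : GeneratedBy r B := by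
  classical
  have hle : ∀ t : Finset ι, t.card ≤ r := by
    intro t
    obtain ⟨H, hHB, hH, htH⟩ := h (t.image fun i => (b i : F)) (by
      intro x hx
      obtain ⟨i, -, rfl⟩ := Finset.mem_image.1 hx
      exact (b i).2)
    have hmem : ∀ i : t, (b i : F) ∈ H := fun i => htH (Finset.mem_image_of_mem _ i.2)
    have := (hH.finite_and_card_le (fun i : t => (⟨b i, hmem i⟩ : H)) fun g =>
      ⟨(b.lift fun i => if hi : i ∈ t then g ⟨i, hi⟩ else 1).comp (Subgroup.inclusion hHB),
        fun i => by
          have : Subgroup.inclusion hHB ⟨b i, hmem i⟩ = b i := rfl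
          rw [MonoidHom.comp_apply, this]
          simp⟩).2
    rwa [Nat.card_eq_fintype_card, Fintype.card_coe] at this
  have hfin : Finite ι := by
    by_contra hinf
    rw [not_finite_iff_infinite] at hinf
    obtain ⟨t, ht⟩ := Infinite.exists_subset_card_eq ι (r + 1)
    have := hle t
    omega
  have := Fintype.ofFinite ι
  refine ⟨Finset.univ.image fun i => (b i : F), Finset.card_image_le.trans (hle _), ?_⟩
  have h2 := congrArg (Subgroup.map B.subtype) b.closure_range_eq_top
  rw [MonoidHom.map_closure, ← MonoidHom.range_eq_map, Subgroup.range_subtype, ← Set.range_comp]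
    at h2
  rw [Finset.coe_image, Finset.coe_univ, Set.image_univ]
  exact h2

/-- Let `F` be a free group of finite rank and `A` a nonabelian
subgroup of `F`. Then `acl^∃(A)` is compressed: for every finitely generated subgroup
`K` with `acl^∃(A) ≤ K ≤ F`, one has `rk(acl^∃(A)) ≤ rk(K)`. -/
theorem aclE_compressed {F : Type*} [Group F] (hF : IsFreeOfFiniteRank F)
    (A : Subgroup F) (hA : Nonabelian (A : Set F)) :
    ∀ K : Subgroup F, K.FG → aclE (A : Set F) ⊆ (K : Set F) →
      srank (Subgroup.closure (aclE (A : Set F))) ≤ srank K := by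
  intro K hK hAK
  obtain ⟨n, ⟨e⟩⟩ := hF
  have : IsFreeGroup F := (FreeGroupBasis.ofRepr e).isFreeGroup
  obtain ⟨r, hr, hrank⟩ := exists_generatedBy_eq_srank hK
  rw [hrank]
  refine srank_le_of_generatedBy
    ((IsFreeGroup.basis (Subgroup.closure (aclE (A : Set F)))).generatedBy_of_forall_finset
      fun B₀ hB₀ => ?_)
  exact (FreeGroupBasis.ofRepr e).exists_generatedBy_le hr ((Subgroup.closure_le K).2 hAK)
    (fun H hH hHA B₁ hB₁ hBH => exists_lt_generatedBy_of_not_le_aclE e hH hHA hB₁ hBH) B₀ hB₀
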